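/- arXiv:1508.05408 — 3 statements merged into one kernel-verified Lean document; each statement's English description precedes it below -/
import Mathlib

section
/- If (u,m) is a smooth solution of the MFG system, then u(t,x) ≥ 0 for all (t,x) ∈ [0,T]×[0,L]. -/
open Set MeasureTheory intervalIntegral Function

noncomputable section

/-- Spatial derivative `u_x`. -/
def pdx (u : ℝ → ℝ → ℝ) (t x : ℝ) : ℝ := deriv (u t) x

/-- Second spatial derivative `u_xx`. -/
def pdxx (u : ℝ → ℝ → ℝ) (t x : ℝ) : ℝ := deriv (deriv (u t)) x

/-- Time derivative `u_t`. -/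
def pdt (u : ℝ → ℝ → ℝ) (t x : ℝ) : ℝ := deriv (fun s => u s x) t

/-- `η(t) = ∫₀^L m(t,x) dx`. -/
def mfgEta (L : ℝ) (m : ℝ → ℝ → ℝ) (t : ℝ) : ℝ := ∫ x in (0:ℝ)..L, m t x

/-- `f(t) = a(η(t)) + c(η(t)) p̄(t)`. -/
def mfgF (L ε : ℝ) (u m : ℝ → ℝ → ℝ) (t : ℝ) : ℝ :=
  2 / (2 + ε * mfgEta L m t)
    + (ε / (2 + ε * mfgEta L m t)) * ∫ x in (0:ℝ)..L, pdx u t x * m t x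

/-- `G(t,x) = (1/2)(f(t) − u_x(t,x))`. -/
def mfgG (L ε : ℝ) (u m : ℝ → ℝ → ℝ) (t x : ℝ) : ℝ :=
  (1/2) * (mfgF L ε u m t - pdx u t x)

/-- `H(t,x) = G(t,x)²`. -/
def mfgH (L ε : ℝ) (u m : ℝ → ℝ → ℝ) (t x : ℝ) : ℝ := (mfgG L ε u m t x)^2

/-- Standing assumptions on the data. -/
structure MFGData (T L σ r ε : ℝ) (uT m0 : ℝ → ℝ) : Prop where
  hT : 0 < T
  hL : 0 < L
  hσ : 0 < σ
  hr : 0 < r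
  hε : 0 ≤ ε
  uT_smooth : ContDiff ℝ 2 uT
  m0_smooth : ContDiff ℝ 2 m0
  uT_zero : uT 0 = 0
  uT_deriv_L : deriv uT L = 0
  uT_nonneg : ∀ x ∈ Icc (0:ℝ) L, 0 ≤ uT x
  uT_deriv_nonneg : ∀ x ∈ Icc (0:ℝ) L, 0 ≤ deriv uT x
  m0_zero : m0 0 = 0
  m0_L : m0 L = 0
  m0_deriv_L : deriv m0 L = 0
  m0_nonneg : ∀ x ∈ Icc (0:ℝ) L, 0 ≤ m0 x
  m0_mass : (∫ x in (0:ℝ)..L, m0 x) = 1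

/-- A smooth solution of the MFG system \eqref{main system}. -/
structure IsMFGSolution (T L σ r ε : ℝ) (uT m0 : ℝ → ℝ) (u m : ℝ → ℝ → ℝ) : Prop where
  u_smooth : ContDiff ℝ (⊤ : ℕ∞) (uncurry u)
  m_smooth : ContDiff ℝ (⊤ : ℕ∞) (uncurry m)
  hjb : ∀ t ∈ Ioo (0:ℝ) T, ∀ x ∈ Ioo (0:ℝ) L,
    pdt u t x + σ^2/2 * pdxx u t x - r * u t x + mfgH L ε u m t x = 0
  fp : ∀ t ∈ Ioo (0:ℝ) T, ∀ x ∈ Ioo (0:ℝ) L,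
    pdt m t x - σ^2/2 * pdxx m t x
      - deriv (fun y => mfgG L ε u m t y * m t y) x = 0
  m_init : ∀ x ∈ Icc (0:ℝ) L, m 0 x = m0 x
  u_term : ∀ x ∈ Icc (0:ℝ) L, u T x = uT x
  u_bdry : ∀ t ∈ Icc (0:ℝ) T, u t 0 = 0
  m_bdry : ∀ t ∈ Icc (0:ℝ) T, m t 0 = 0
  ux_bdry : ∀ t ∈ Icc (0:ℝ) T, pdx u t L = 0
  m_flux : ∀ t ∈ Icc (0:ℝ) T,
    σ^2/2 * pdx m t L + mfgG L ε u m t L * m t L = 0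

end

/-- A function that on `[a, b]` is smallest at the left end has nonnegative derivative there. -/
theorem HasDerivAt.nonneg_of_le_right {g : ℝ → ℝ} {d a b : ℝ} (hab : a < b)
    (hg : HasDerivAt g d a) (h : ∀ t ∈ Icc a b, g a ≤ g t) : 0 ≤ d := by
  refine ge_of_tendsto (hasDerivWithinAt_iff_tendsto_slope' self_notMem_Ioi |>.1
    (hg.hasDerivWithinAt (s := Ioi a))) ?_
  filter_upwards [Ioo_mem_nhdsGT hab] with t ht
  rw [slope_def_field]
  exact div_nonneg (sub_nonneg.2 (h t ⟨ht.1.le, ht.2.le⟩)) (sub_nonneg.2 ht.1.le)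

/-- A function that on `[b, a]` is smallest at the right end has nonpositive derivative there. -/
theorem HasDerivAt.nonpos_of_le_left {g : ℝ → ℝ} {d a b : ℝ} (hba : b < a)
    (hg : HasDerivAt g d a) (h : ∀ t ∈ Icc b a, g a ≤ g t) : d ≤ 0 := by
  refine le_of_tendsto (hasDerivWithinAt_iff_tendsto_slope' self_notMem_Iio |>.1
    (hg.hasDerivWithinAt (s := Iio a))) ?_
  filter_upwards [Ioo_mem_nhdsLT hba] with t ht
  rw [slope_def_field]
  exact div_nonpos_of_nonneg_of_nonpos (sub_nonneg.2 (h t ⟨ht.1.le, ht.2.le⟩))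
    (sub_nonpos.2 ht.2.le)

/-- The second derivative is nonnegative at a local minimum. -/
theorem IsLocalMin.deriv_deriv_nonneg {g : ℝ → ℝ} {a : ℝ} (h : IsLocalMin g a)
    (hc : ContinuousAt g a) : 0 ≤ deriv (deriv g) a := by
  by_contra! hneg
  have hmax := isLocalMax_of_deriv_deriv_neg hneg h.deriv_eq_zero hc
  have hconst : g =ᶠ[nhds a] fun _ => g a := by
    filter_upwards [h, hmax] with y h1 h2 using le_antisymm h2 h1
  have := hconst.deriv.deriv_eq
  simp at this
  linarith

/-- Minimum principle: a supersolution of the backward equation `u_t + κ u_xx - r u = 0` on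
`[s, T) × (0, L)` that is nonnegative at `x = 0` and `t = T` and has zero flux at `x = L` is
nonnegative. -/
theorem nonneg_of_backward_supersolution {s T L κ r : ℝ} (hL : 0 < L) (hκ : 0 ≤ κ) (hr : 0 < r)
    {u : ℝ → ℝ → ℝ} (hu : ContDiff ℝ 1 (uncurry u))
    (hpde : ∀ t ∈ Ico s T, ∀ x ∈ Ioo (0 : ℝ) L, pdt u t x + κ * pdxx u t x - r * u t x ≤ 0)
    (hterm : ∀ x ∈ Icc (0 : ℝ) L, 0 ≤ u T x)
    (hzero : ∀ t ∈ Icc s T, 0 ≤ u t 0) (hflux : ∀ t ∈ Icc s T, pdx u t L = 0) :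
    ∀ t ∈ Icc s T, ∀ x ∈ Icc (0 : ℝ) L, 0 ≤ u t x := by
  intro t ht x hx
  have hdx : ∀ t, Differentiable ℝ (u t) := fun t =>
    (hu.comp (contDiff_const.prodMk contDiff_id) : ContDiff ℝ 1 fun y => uncurry u (t, y))
      |>.differentiable one_ne_zero
  have hdt : ∀ x, Differentiable ℝ (fun t => u t x) := fun x =>
    (hu.comp (contDiff_id.prodMk contDiff_const) : ContDiff ℝ 1 fun y => uncurry u (y, x))
      |>.differentiable one_ne_zero
  have key : ∀ δ > 0, 0 ≤ u t x + δ * x := by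
    intro δ hδ
    have hcont : Continuous fun p : ℝ × ℝ => uncurry u p + δ * p.2 :=
      hu.continuous.add (by fun_prop)
    obtain ⟨⟨t₀, x₀⟩, ⟨ht₀, hx₀⟩, hmin⟩ := (isCompact_Icc.prod isCompact_Icc).exists_isMinOn
      (⟨(t, x), ht, hx⟩ : (Icc s T ×ˢ Icc (0 : ℝ) L).Nonempty) hcont.continuousOn
    replace hmin : ∀ t ∈ Icc s T, ∀ x ∈ Icc (0 : ℝ) L, u t₀ x₀ + δ * x₀ ≤ u t x + δ * x :=
      fun t ht x hx => hmin (mk_mem_prod ht hx)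
    by_contra! hneg
    replace hneg : u t₀ x₀ + δ * x₀ < 0 := (hmin t ht x hx).trans_lt hneg
    have hδx : 0 ≤ δ * x₀ := mul_nonneg hδ.le hx₀.1
    have hderiv : ∀ y, HasDerivAt (fun y => u t₀ y + δ * y) (deriv (u t₀) y + δ) y := fun y => by
      simpa using (hdx t₀ y).hasDerivAt.fun_add ((hasDerivAt_id y).const_mul δ)
    have htT : t₀ < T := ht₀.2.lt_of_ne fun h => by
      subst h
      linarith [hterm x₀ hx₀]
    have hx_pos : 0 < x₀ := hx₀.1.lt_of_ne fun h => by
      subst h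
      linarith [hzero t₀ ht₀]
    have hxL : x₀ < L := hx₀.2.lt_of_ne fun h => by
      subst h
      have := (hderiv x₀).nonpos_of_le_left hL (hmin t₀ ht₀)
      have hf : deriv (u t₀) x₀ = 0 := hflux t₀ ht₀
      linarith
    have h_time : 0 ≤ pdt u t₀ x₀ :=
      (hdt x₀ t₀).hasDerivAt.nonneg_of_le_right htT fun t ht => by
        linarith [hmin t ⟨ht₀.1.trans ht.1, ht.2⟩ x₀ hx₀]
    have h_space : 0 ≤ pdxx u t₀ x₀ := by
      have hloc : IsLocalMin (fun y => u t₀ y + δ * y) x₀ := by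
        filter_upwards [Icc_mem_nhds hx_pos hxL] with y hy using hmin t₀ ht₀ y hy
      have := hloc.deriv_deriv_nonneg (hderiv x₀).continuousAt
      rwa [funext fun y => (hderiv y).deriv, deriv_add_const] at this
    have hp := hpde t₀ ⟨ht₀.1, htT⟩ x₀ ⟨hx_pos, hxL⟩
    nlinarith [mul_nonneg hκ h_space]
  have hlim : Filter.Tendsto (fun δ : ℝ => u t x + δ * x) (nhdsWithin 0 (Ioi 0))
      (nhds (u t x)) := by
    have : Continuous fun δ : ℝ => u t x + δ * x := by fun_prop
    simpa using (this.tendsto 0).mono_left nhdsWithin_le_nhds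
  exact ge_of_tendsto hlim (Filter.eventually_of_mem self_mem_nhdsWithin key)

/-- If (u,m) is a smooth solution of the MFG system, then u(t,x) ≥ 0. -/
theorem mfg_u_nonneg (T L σ r ε : ℝ) (uT m0 : ℝ → ℝ)
    (hdata : MFGData T L σ r ε uT m0)
    (u m : ℝ → ℝ → ℝ) (hsol : IsMFGSolution T L σ r ε uT m0 u m) :
    ∀ t ∈ Icc (0:ℝ) T, ∀ x ∈ Icc (0:ℝ) L, 0 ≤ u t x := by
  have hT := hdata.hT
  have hpos : ∀ t ∈ Ioc (0 : ℝ) T, ∀ x ∈ Icc (0 : ℝ) L, 0 ≤ u t x := by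
    intro t ht
    refine nonneg_of_backward_supersolution (s := t) (κ := σ ^ 2 / 2) hdata.hL (by positivity)
      hdata.hr (hsol.u_smooth.of_le (by exact_mod_cast le_top)) ?_ ?_ ?_ ?_ t ⟨le_rfl, ht.2⟩
    · intro t' ht' x hx
      have h1 := hsol.hjb t' ⟨ht.1.trans_le ht'.1, ht'.2⟩ x hx
      have h2 : 0 ≤ mfgH L ε u m t' x := sq_nonneg _
      linarith
    · exact fun x hx => (hsol.u_term x hx).symm ▸ hdata.uT_nonneg x hx
    · exact fun t' ht' => (hsol.u_bdry t' ⟨ht.1.le.trans ht'.1, ht'.2⟩).ge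
    · exact fun t' ht' => hsol.ux_bdry t' ⟨ht.1.le.trans ht'.1, ht'.2⟩
  intro t ht x hx
  rcases ht.1.eq_or_lt with rfl | h0
  · have hc : Continuous fun t => u t x :=
      hsol.u_smooth.continuous.comp (continuous_id.prodMk continuous_const)
    refine ge_of_tendsto ((hc.tendsto 0).mono_left (nhdsWithin_le_nhds (s := Ioi 0))) ?_
    filter_upwards [Ioo_mem_nhdsGT hT] with t ht using hpos t ⟨ht.1, ht.2.le⟩ x hx
  · exact hpos t ⟨h0, ht.2⟩ x hx
end

section
/- If (u,m) is a smooth solution of the MFG system, then ∫₀^T ∫₀^L m(t,x) u_x(t,x)² dx dt ≤ (2+ε)(1+ε)T + 4(2+ε)‖u_T‖_∞, where ‖u_T‖_∞ = sup_{x∈[0,L]} |u_T(x)|. -/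
open Set MeasureTheory intervalIntegral Function

theorem nonpos_of_hasDerivAt_of_forall_Icc_left_le {h : ℝ → ℝ} {d a b : ℝ} (hab : a < b)
    (hd : HasDerivAt h d b) (hmin : ∀ t ∈ Icc a b, h b ≤ h t) : d ≤ 0 := by
  have hs : Filter.Tendsto (slope h b) (nhdsWithin b (Iio b)) (nhds d) :=
    (hasDerivWithinAt_iff_tendsto_slope' (by simp)).1 hd.hasDerivWithinAt
  refine le_of_tendsto hs ?_
  filter_upwards [Ioo_mem_nhdsLT hab] with t ht
  rw [slope_def_field]
  exact div_nonpos_of_nonneg_of_nonpos (sub_nonneg.2 (hmin t ⟨ht.1.le, ht.2.le⟩))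
    (sub_nonpos.2 ht.2.le)

theorem nonneg_of_hasDerivAt_of_forall_Icc_right_le {h : ℝ → ℝ} {d a b : ℝ} (hab : a < b)
    (hd : HasDerivAt h d a) (hmin : ∀ t ∈ Icc a b, h a ≤ h t) : 0 ≤ d := by
  have hs : Filter.Tendsto (slope h a) (nhdsWithin a (Ioi a)) (nhds d) :=
    (hasDerivWithinAt_iff_tendsto_slope' (by simp)).1 hd.hasDerivWithinAt
  refine ge_of_tendsto hs ?_
  filter_upwards [Ioo_mem_nhdsGT hab] with t ht
  rw [slope_def_field]
  exact div_nonneg (sub_nonneg.2 (hmin t ⟨ht.1.le, ht.2.le⟩)) (sub_nonneg.2 ht.1.le)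

theorem IsLocalMin.second_deriv_nonneg {g g' : ℝ → ℝ} {d x : ℝ}
    (hg : ∀ y, HasDerivAt g (g' y) y) (hg' : HasDerivAt g' d x) (hmin : IsLocalMin g x) :
    0 ≤ d := by
  by_contra! hd
  have hgd : deriv g = g' := funext fun y => (hg y).deriv
  have hmax : IsLocalMax g x := by
    refine isLocalMax_of_deriv_deriv_neg ?_ ?_ (hg x).continuousAt
    · rw [hgd, hg'.deriv]; exact hd
    · exact hmin.deriv_eq_zero
  have hconst : g =ᶠ[nhds x] fun _ => g x := by
    filter_upwards [hmin, hmax] with y h1 h2 using le_antisymm h2 h1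
  have h0 : deriv g =ᶠ[nhds x] fun _ => 0 := by
    simpa using hconst.deriv
  have : deriv (deriv g) x = 0 := by
    rw [h0.deriv_eq]; simp
  rw [hgd, hg'.deriv] at this
  exact hd.ne this

section PartialDerivatives

variable {u : ℝ → ℝ → ℝ}

theorem hasDerivAt_pdx (hu : ContDiff ℝ (⊤ : ℕ∞) (uncurry u)) (t x : ℝ) :
    HasDerivAt (u t) (pdx u t x) x := by
  have : Differentiable ℝ fun y => uncurry u (t, y) :=
    (hu.differentiable (by simp)).comp (by fun_prop)
  exact (this x).hasDerivAt

theorem hasDerivAt_pdt (hu : ContDiff ℝ (⊤ : ℕ∞) (uncurry u)) (t x : ℝ) :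
    HasDerivAt (fun s => u s x) (pdt u t x) t := by
  have : Differentiable ℝ fun s => uncurry u (s, x) :=
    (hu.differentiable (by simp)).comp (by fun_prop)
  exact (this t).hasDerivAt

theorem contDiff_pdx (hu : ContDiff ℝ (⊤ : ℕ∞) (uncurry u)) :
    ContDiff ℝ (⊤ : ℕ∞) (uncurry (pdx u)) := by
  have h : uncurry (pdx u) = fun p => fderiv ℝ (uncurry u) p (0, 1) := by
    ext ⟨t, x⟩
    have h1 := ((hu.differentiable (by simp)) (t, x)).hasFDerivAt.comp_hasDerivAt x
      ((hasDerivAt_const x t).prodMk (hasDerivAt_id x))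
    exact (hasDerivAt_pdx hu t x).unique h1
  rw [h]
  exact (hu.fderiv_right (m := (⊤ : ℕ∞)) (by simp)).clm_apply contDiff_const

theorem contDiff_pdt (hu : ContDiff ℝ (⊤ : ℕ∞) (uncurry u)) :
    ContDiff ℝ (⊤ : ℕ∞) (uncurry (pdt u)) := by
  have h : uncurry (pdt u) = fun p => fderiv ℝ (uncurry u) p (1, 0) := by
    ext ⟨t, x⟩
    have h1 := ((hu.differentiable (by simp)) (t, x)).hasFDerivAt.comp_hasDerivAt t
      ((hasDerivAt_id t).prodMk (hasDerivAt_const t x))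
    exact (hasDerivAt_pdt hu t x).unique h1
  rw [h]
  exact (hu.fderiv_right (m := (⊤ : ℕ∞)) (by simp)).clm_apply contDiff_const

theorem hasDerivAt_pdxx (hu : ContDiff ℝ (⊤ : ℕ∞) (uncurry u)) (t x : ℝ) :
    HasDerivAt (pdx u t) (pdxx u t x) x :=
  hasDerivAt_pdx (contDiff_pdx hu) t x

theorem continuous_uncurry_pdxx (hu : ContDiff ℝ (⊤ : ℕ∞) (uncurry u)) :
    Continuous (uncurry (pdxx u)) :=
  (contDiff_pdx (contDiff_pdx hu)).continuous

/-- The time increment of the spatial integral is the iterated integral of the time derivative. -/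
theorem integral_integral_pdt (hu : ContDiff ℝ (⊤ : ℕ∞) (uncurry u)) (a b c d : ℝ) :
    ∫ t in a..b, ∫ x in c..d, pdt u t x = (∫ x in c..d, u b x) - ∫ x in c..d, u a x := by
  have hc : Continuous (uncurry u) := hu.continuous
  have hct : Continuous (uncurry (pdt u)) := (contDiff_pdt hu).continuous
  rw [intervalIntegral_intervalIntegral_swap
      ((hct.continuousOn.integrableOn_compact (isCompact_uIcc.prod isCompact_uIcc)).mono_set
        (prod_mono uIoc_subset_uIcc uIoc_subset_uIcc)), ← intervalIntegral.integral_sub]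
  · refine intervalIntegral.integral_congr fun x _ => ?_
    exact integral_eq_sub_of_hasDerivAt (fun t _ => hasDerivAt_pdt hu t x)
      (Continuous.intervalIntegrable (by fun_prop) _ _)
  · exact Continuous.intervalIntegrable (by fun_prop) _ _
  · exact Continuous.intervalIntegrable (by fun_prop) _ _

end PartialDerivatives

section Solution

variable {T L σ r ε : ℝ} {uT m0 : ℝ → ℝ} {u m : ℝ → ℝ → ℝ}

theorem continuous_mfgEta (hm : ContDiff ℝ (⊤ : ℕ∞) (uncurry m)) :
    Continuous (mfgEta L m) :=
  intervalIntegral.continuous_parametric_intervalIntegral_of_continuous' hm.continuous 0 L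

theorem hasDerivAt_mfgG (hu : ContDiff ℝ (⊤ : ℕ∞) (uncurry u)) (t x : ℝ) :
    HasDerivAt (mfgG L ε u m t) (-(1 / 2) * pdxx u t x) x := by
  have h := ((hasDerivAt_pdxx hu t x).const_sub (mfgF L ε u m t)).const_mul (1 / 2 : ℝ)
  refine h.congr_deriv ?_
  ring

theorem continuousOn_mfgF (hu : ContDiff ℝ (⊤ : ℕ∞) (uncurry u))
    (hm : ContDiff ℝ (⊤ : ℕ∞) (uncurry m)) {s : Set ℝ}
    (hs : ∀ t ∈ s, 0 < 2 + ε * mfgEta L m t) : ContinuousOn (mfgF L ε u m) s := by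
  have hη : Continuous (mfgEta L m) := continuous_mfgEta hm
  have hP : Continuous fun t => ∫ x in (0:ℝ)..L, pdx u t x * m t x :=
    intervalIntegral.continuous_parametric_intervalIntegral_of_continuous'
      (f := fun t x => pdx u t x * m t x)
      ((contDiff_pdx hu).continuous.mul hm.continuous) 0 L
  unfold mfgF
  refine ContinuousOn.add (ContinuousOn.div (by fun_prop) (by fun_prop) fun t ht => (hs t ht).ne')
    (ContinuousOn.mul (ContinuousOn.div (by fun_prop) (by fun_prop) fun t ht => (hs t ht).ne')
      hP.continuousOn)

theorem IsMFGSolution.u_nonneg (hdata : MFGData T L σ r ε uT m0)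
    (hsol : IsMFGSolution T L σ r ε uT m0 u m) {s y : ℝ} (hs : s ∈ Ioo 0 T) (hy : y ∈ Icc 0 L) :
    0 ≤ u s y := by
  by_contra! hneg
  have hL := hdata.hL
  obtain ⟨δ, hδ, hδy⟩ : ∃ δ > 0, u s y + δ * y < 0 := by
    refine ⟨-u s y / (2 * L), div_pos (by linarith) (by linarith), ?_⟩
    have : -u s y / (2 * L) * y ≤ -u s y / (2 * L) * L :=
      mul_le_mul_of_nonneg_left hy.2 (div_nonneg (by linarith) (by linarith))
    have h2 : -u s y / (2 * L) * L = -u s y / 2 := by field_simp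
    linarith
  have hc : Continuous (uncurry u) := hsol.u_smooth.continuous
  have hw : Continuous fun p : ℝ × ℝ => u p.1 p.2 + δ * p.2 := by
    have : Continuous fun p : ℝ × ℝ => u p.1 p.2 := hc
    fun_prop
  obtain ⟨⟨t₀, x₀⟩, ⟨ht₀, hx₀⟩, hmin⟩ :=
    (isCompact_Icc.prod isCompact_Icc : IsCompact (Icc s T ×ˢ Icc 0 L)).exists_isMinOn
      ⟨(s, y), ⟨⟨le_rfl, hs.2.le⟩, hy⟩⟩ hw.continuousOn
  have hle : ∀ t ∈ Icc s T, ∀ x ∈ Icc 0 L, u t₀ x₀ + δ * x₀ ≤ u t x + δ * x :=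
    fun t ht x hx => hmin (show (t, x) ∈ Icc s T ×ˢ Icc 0 L from ⟨ht, hx⟩)
  have hwneg : u t₀ x₀ + δ * x₀ < 0 := (hle s ⟨le_rfl, hs.2.le⟩ y hy).trans_lt hδy
  simp only at ht₀ hx₀
  have ht₀' : t₀ ∈ Icc 0 T := ⟨hs.1.le.trans ht₀.1, ht₀.2⟩
  have hδx : 0 ≤ δ * x₀ := mul_nonneg hδ.le hx₀.1
  have htT : t₀ < T := by
    refine lt_of_le_of_ne ht₀.2 ?_
    rintro rfl
    have := hdata.uT_nonneg x₀ hx₀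
    rw [hsol.u_term x₀ hx₀] at hwneg
    linarith
  have hx0 : 0 < x₀ := by
    refine lt_of_le_of_ne hx₀.1 ?_
    rintro rfl
    rw [hsol.u_bdry t₀ ht₀'] at hwneg
    linarith
  have hdx : ∀ x, HasDerivAt (fun x => u t₀ x + δ * x) (pdx u t₀ x + δ) x := fun x =>
    ((hasDerivAt_pdx hsol.u_smooth t₀ x).add ((hasDerivAt_id x).const_mul δ)).congr_deriv
      (by ring)
  have hxL : x₀ < L := by
    refine lt_of_le_of_ne hx₀.2 ?_
    rintro rfl
    have := nonpos_of_hasDerivAt_of_forall_Icc_left_le hL (hdx x₀) fun x hx => hle t₀ ht₀ x hx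
    rw [hsol.ux_bdry t₀ ht₀'] at this
    linarith
  have hdt : 0 ≤ pdt u t₀ x₀ := by
    refine nonneg_of_hasDerivAt_of_forall_Icc_right_le htT (hasDerivAt_pdt hsol.u_smooth t₀ x₀)
      fun t ht => ?_
    have := hle t ⟨ht₀.1.trans ht.1, ht.2⟩ x₀ hx₀
    linarith
  have hdxx : 0 ≤ pdxx u t₀ x₀ := by
    refine IsLocalMin.second_deriv_nonneg hdx
      ((hasDerivAt_pdxx hsol.u_smooth t₀ x₀).add_const δ) ?_
    filter_upwards [Icc_mem_nhds hx0 hxL] with x hx using hle t₀ ht₀ x hx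
  have hpde := hsol.hjb t₀ ⟨hs.1.trans_le ht₀.1, htT⟩ x₀ ⟨hx0, hxL⟩
  have hH : 0 ≤ mfgH L ε u m t₀ x₀ := sq_nonneg _
  have h1 : 0 ≤ σ ^ 2 / 2 * pdxx u t₀ x₀ := mul_nonneg (by positivity) hdxx
  have h2 : r * u t₀ x₀ < 0 := mul_neg_of_pos_of_neg hdata.hr (by linarith)
  linarith

theorem IsMFGSolution.fp_expanded (hsol : IsMFGSolution T L σ r ε uT m0 u m) {t x : ℝ}
    (ht : t ∈ Ioo 0 T) (hx : x ∈ Ioo 0 L) :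
    pdt m t x = σ ^ 2 / 2 * pdxx m t x
      + (-(1 / 2) * pdxx u t x * m t x + mfgG L ε u m t x * pdx m t x) := by
  have h := hsol.fp t ht x hx
  rw [((hasDerivAt_mfgG hsol.u_smooth t x).fun_mul (hasDerivAt_pdx hsol.m_smooth t x)).deriv] at h
  linarith

theorem IsMFGSolution.m_nonneg_of_denominator_pos (hdata : MFGData T L σ r ε uT m0)
    (hsol : IsMFGSolution T L σ r ε uT m0 u m) {t₁ : ℝ} (ht₁ : t₁ ∈ Ioo 0 T)
    (hpos : ∀ t ∈ Icc 0 t₁, 0 < 2 + ε * mfgEta L m t) {s y : ℝ} (hs : s ∈ Icc 0 t₁)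
    (hy : y ∈ Icc 0 L) : 0 ≤ m s y := by
  by_contra! hneg
  have hL := hdata.hL
  have hσ := hdata.hσ
  have hK : IsCompact (Icc 0 t₁ ×ˢ Icc 0 L) := isCompact_Icc.prod isCompact_Icc
  obtain ⟨A, hA⟩ := isCompact_Icc.exists_bound_of_continuousOn
    (continuousOn_mfgF hsol.u_smooth hsol.m_smooth hpos)
  obtain ⟨B, hB⟩ := hK.exists_bound_of_continuousOn
    (contDiff_pdx hsol.u_smooth).continuous.continuousOn
  obtain ⟨C, hC⟩ := hK.exists_bound_of_continuousOn
    (continuous_uncurry_pdxx hsol.u_smooth).continuousOn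
  have hA0 : 0 ≤ A := (norm_nonneg _).trans (hA 0 ⟨le_rfl, ht₁.1.le⟩)
  set k := A / σ ^ 2 + 1 with hk
  have hk0 : 0 ≤ k := by positivity
  have hkσ : σ ^ 2 * k = A + σ ^ 2 := by rw [hk]; field_simp
  set l := σ ^ 2 / 2 * k ^ 2 + (A + B) / 2 * k + C / 2 + 1 with hl
  have hc : Continuous fun p : ℝ × ℝ => m p.1 p.2 := hsol.m_smooth.continuous
  have hw : Continuous fun p : ℝ × ℝ => Real.exp (-l * p.1 - k * p.2) * m p.1 p.2 := by
    fun_prop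
  obtain ⟨⟨t₀, x₀⟩, ⟨ht₀, hx₀⟩, hmin⟩ := hK.exists_isMinOn ⟨(s, y), ⟨hs, hy⟩⟩ hw.continuousOn
  have hle : ∀ t ∈ Icc 0 t₁, ∀ x ∈ Icc 0 L, Real.exp (-l * t₀ - k * x₀) * m t₀ x₀
      ≤ Real.exp (-l * t - k * x) * m t x :=
    fun t ht x hx => hmin (show (t, x) ∈ Icc 0 t₁ ×ˢ Icc 0 L from ⟨ht, hx⟩)
  simp only at ht₀ hx₀
  have hmneg : m t₀ x₀ < 0 := by
    have h1 := (hle s hs y hy).trans_lt (mul_neg_of_pos_of_neg (Real.exp_pos _) hneg)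
    exact (pos_iff_neg_of_mul_neg h1).1 (Real.exp_pos _)
  have ht₀' : t₀ ∈ Icc 0 T := ⟨ht₀.1, ht₀.2.trans ht₁.2.le⟩
  have ht0 : 0 < t₀ := by
    refine lt_of_le_of_ne ht₀.1 ?_
    rintro rfl
    rw [hsol.m_init x₀ hx₀] at hmneg
    exact hmneg.not_ge (hdata.m0_nonneg x₀ hx₀)
  have hx0 : 0 < x₀ := by
    refine lt_of_le_of_ne hx₀.1 ?_
    rintro rfl
    rw [hsol.m_bdry t₀ ht₀'] at hmneg
    exact hmneg.false
  have hexp : ∀ x, HasDerivAt (fun x => Real.exp (-l * t₀ - k * x))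
      (Real.exp (-l * t₀ - k * x) * (-k)) x := fun x =>
    ((((hasDerivAt_id x).const_mul k).const_sub (-l * t₀)).exp).congr_deriv (by simp)
  have hdx : ∀ x, HasDerivAt (fun x => Real.exp (-l * t₀ - k * x) * m t₀ x)
      (Real.exp (-l * t₀ - k * x) * (pdx m t₀ x - k * m t₀ x)) x := fun x =>
    ((hexp x).fun_mul (hasDerivAt_pdx hsol.m_smooth t₀ x)).congr_deriv (by ring)
  have hdxx : HasDerivAt (fun x => Real.exp (-l * t₀ - k * x) * (pdx m t₀ x - k * m t₀ x))
      (Real.exp (-l * t₀ - k * x₀) *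
        (pdxx m t₀ x₀ - 2 * k * pdx m t₀ x₀ + k ^ 2 * m t₀ x₀)) x₀ :=
    ((hexp x₀).fun_mul ((hasDerivAt_pdxx hsol.m_smooth t₀ x₀).fun_sub
      ((hasDerivAt_pdx hsol.m_smooth t₀ x₀).const_mul k))).congr_deriv (by ring)
  have hdt : HasDerivAt (fun t => Real.exp (-l * t - k * x₀) * m t x₀)
      (Real.exp (-l * t₀ - k * x₀) * (pdt m t₀ x₀ - l * m t₀ x₀)) t₀ := by
    have h1 : HasDerivAt (fun t => Real.exp (-l * t - k * x₀))
        (Real.exp (-l * t₀ - k * x₀) * (-l)) t₀ :=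
      ((((hasDerivAt_id t₀).const_mul (-l)).sub_const (k * x₀)).exp).congr_deriv (by simp)
    exact (h1.fun_mul (hasDerivAt_pdt hsol.m_smooth t₀ x₀)).congr_deriv (by ring)
  have hF : |mfgF L ε u m t₀| ≤ A := hA t₀ ht₀
  have hxL : x₀ < L := by
    refine lt_of_le_of_ne hx₀.2 ?_
    rintro rfl
    have h1 := nonpos_of_hasDerivAt_of_forall_Icc_left_le hL (hdx x₀) fun x hx => hle t₀ ht₀ x hx
    have h2 : pdx m t₀ x₀ - k * m t₀ x₀ ≤ 0 := by
      by_contra! h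
      exact h1.not_gt (mul_pos (Real.exp_pos _) h)
    have h3 := hsol.m_flux t₀ ht₀'
    rw [mfgG, hsol.ux_bdry t₀ ht₀'] at h3
    have h4 : σ ^ 2 * pdx m t₀ x₀ ≤ σ ^ 2 * (k * m t₀ x₀) :=
      mul_le_mul_of_nonneg_left (by linarith) (by positivity)
    rw [← mul_assoc, hkσ] at h4
    have h5 : (A + mfgF x₀ ε u m t₀) * m t₀ x₀ ≤ 0 :=
      mul_nonpos_of_nonneg_of_nonpos (by linarith [(abs_le.1 hF).1]) hmneg.le
    have h6 : σ ^ 2 * m t₀ x₀ < 0 := mul_neg_of_pos_of_neg (by positivity) hmneg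
    linarith
  have hloc : IsLocalMin (fun x => Real.exp (-l * t₀ - k * x) * m t₀ x) x₀ := by
    filter_upwards [Icc_mem_nhds hx0 hxL] with x hx using hle t₀ ht₀ x hx
  have hx : pdx m t₀ x₀ = k * m t₀ x₀ := by
    have h1 := hloc.hasDerivAt_eq_zero (hdx x₀)
    have h2 := (mul_eq_zero.1 h1).resolve_left (Real.exp_pos _).ne'
    linarith
  have hxx : k ^ 2 * m t₀ x₀ ≤ pdxx m t₀ x₀ := by
    have h1 := nonneg_of_mul_nonneg_right (hloc.second_deriv_nonneg hdx hdxx) (Real.exp_pos _)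
    rw [hx] at h1
    linarith
  have ht : pdt m t₀ x₀ ≤ l * m t₀ x₀ := by
    have h1 := nonpos_of_hasDerivAt_of_forall_Icc_left_le ht0 hdt
      fun t ht => hle t ⟨ht.1, ht.2.trans ht₀.2⟩ x₀ hx₀
    by_contra! h
    exact h1.not_gt (mul_pos (Real.exp_pos _) (by linarith))
  have hpde := hsol.fp_expanded ⟨ht0, ht₀.2.trans_lt ht₁.2⟩ ⟨hx0, hxL⟩
  rw [hx] at hpde
  have hb : |pdx u t₀ x₀| ≤ B := hB (t₀, x₀) ⟨ht₀, hx₀⟩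
  have hcc : |pdxx u t₀ x₀| ≤ C := hC (t₀, x₀) ⟨ht₀, hx₀⟩
  have hGk : mfgG L ε u m t₀ x₀ * k ≤ (A + B) / 2 * k := by
    refine mul_le_mul_of_nonneg_right ?_ hk0
    rw [mfgG]
    linarith [(abs_le.1 hF).2, (abs_le.1 hb).1]
  have hcoef : σ ^ 2 / 2 * k ^ 2 + mfgG L ε u m t₀ x₀ * k - 1 / 2 * pdxx u t₀ x₀ < l := by
    rw [hl]
    linarith [(abs_le.1 hcc).1]
  have h7 : σ ^ 2 / 2 * (k ^ 2 * m t₀ x₀) ≤ σ ^ 2 / 2 * pdxx m t₀ x₀ :=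
    mul_le_mul_of_nonneg_left hxx (by positivity)
  have h8 := mul_lt_mul_of_neg_right hcoef hmneg
  linarith

theorem mfgEta_nonneg {t : ℝ} (hL : 0 ≤ L) (h : ∀ x ∈ Icc 0 L, 0 ≤ m t x) :
    0 ≤ mfgEta L m t :=
  intervalIntegral.integral_nonneg hL h

theorem nonneg_of_forall_Ico_nonneg {g : ℝ → ℝ} (hg : Continuous g) {b : ℝ} (hb : 0 < b)
    (h : ∀ t ∈ Ico 0 b, 0 ≤ g t) : ∀ t ∈ Icc 0 b, 0 ≤ g t := by
  have hsub : closure (Ico 0 b) ⊆ {t | 0 ≤ g t} :=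
    closure_minimal h (isClosed_le continuous_const hg)
  rwa [closure_Ico hb.ne] at hsub

theorem IsMFGSolution.mfgEta_zero (hdata : MFGData T L σ r ε uT m0)
    (hsol : IsMFGSolution T L σ r ε uT m0 u m) : mfgEta L m 0 = 1 := by
  rw [← hdata.m0_mass]
  refine intervalIntegral.integral_congr fun x hx => ?_
  rw [uIcc_of_le hdata.hL.le] at hx
  exact hsol.m_init x hx

theorem continuous_section_left (hm : ContDiff ℝ (⊤ : ℕ∞) (uncurry m)) (x : ℝ) :
    Continuous fun t => m t x :=
  hm.continuous.comp (by fun_prop : Continuous fun t : ℝ => (t, x))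

theorem IsMFGSolution.denominator_pos (hdata : MFGData T L σ r ε uT m0)
    (hsol : IsMFGSolution T L σ r ε uT m0 u m) {t : ℝ} (ht : t ∈ Icc 0 T) :
    0 < 2 + ε * mfgEta L m t := by
  by_contra! hneg
  have hη : Continuous (mfgEta L m) := continuous_mfgEta hsol.m_smooth
  have hS : IsCompact (Icc 0 T ∩ {t | 2 + ε * mfgEta L m t ≤ 0}) :=
    isCompact_Icc.inter_right (isClosed_le (by fun_prop) continuous_const)
  obtain ⟨τ, ⟨hτ, hτneg⟩, hτmin⟩ := hS.exists_isLeast ⟨t, ht, hneg⟩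
  have hε := hdata.hε
  change 2 + ε * mfgEta L m τ ≤ 0 at hτneg
  have hτ0 : 0 < τ := by
    refine lt_of_le_of_ne hτ.1 ?_
    rintro rfl
    rw [hsol.mfgEta_zero hdata] at hτneg
    linarith
  have hbefore : ∀ s ∈ Ico 0 τ, 0 < 2 + ε * mfgEta L m s := by
    intro s hs
    by_contra! h
    exact hs.2.not_ge (hτmin ⟨⟨hs.1, hs.2.le.trans hτ.2⟩, h⟩)
  have hm : ∀ x ∈ Icc 0 L, 0 ≤ m τ x := by
    intro x hx
    refine nonneg_of_forall_Ico_nonneg (continuous_section_left hsol.m_smooth x) hτ0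
      (fun s hs => ?_) τ ⟨hτ0.le, le_rfl⟩
    obtain ⟨t₁, h1, h2⟩ := exists_between hs.2
    exact hsol.m_nonneg_of_denominator_pos hdata ⟨hs.1.trans_lt h1, h2.trans_le hτ.2⟩
      (fun s hs => hbefore s ⟨hs.1, hs.2.trans_lt h2⟩) ⟨hs.1, h1.le⟩ hx
  have := mul_nonneg hε (mfgEta_nonneg hdata.hL.le hm)
  linarith

theorem IsMFGSolution.m_nonneg (hdata : MFGData T L σ r ε uT m0)
    (hsol : IsMFGSolution T L σ r ε uT m0 u m) {t x : ℝ} (ht : t ∈ Icc 0 T) (hx : x ∈ Icc 0 L) :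
    0 ≤ m t x := by
  refine nonneg_of_forall_Ico_nonneg (continuous_section_left hsol.m_smooth x) hdata.hT
    (fun s hs => ?_) t ht
  obtain ⟨t₁, h1, h2⟩ := exists_between hs.2
  exact hsol.m_nonneg_of_denominator_pos hdata ⟨hs.1.trans_lt h1, h2⟩
    (fun s hs => hsol.denominator_pos hdata ⟨hs.1, hs.2.trans h2.le⟩) ⟨hs.1, h1.le⟩ hx

theorem IsMFGSolution.integral_pdt_m_nonpos (hdata : MFGData T L σ r ε uT m0)
    (hsol : IsMFGSolution T L σ r ε uT m0 u m) {t : ℝ} (ht : t ∈ Ioo 0 T) :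
    ∫ x in (0:ℝ)..L, pdt m t x ≤ 0 := by
  have hL := hdata.hL
  have ht' : t ∈ Icc 0 T := ⟨ht.1.le, ht.2.le⟩
  have hd : ∀ x, HasDerivAt (fun x => σ ^ 2 / 2 * pdx m t x + mfgG L ε u m t x * m t x)
      (σ ^ 2 / 2 * pdxx m t x
        + (-(1 / 2) * pdxx u t x * m t x + mfgG L ε u m t x * pdx m t x)) x := fun x =>
    ((hasDerivAt_pdxx hsol.m_smooth t x).const_mul _).fun_add
      ((hasDerivAt_mfgG hsol.u_smooth t x).fun_mul (hasDerivAt_pdx hsol.m_smooth t x))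
  have hint : Continuous fun x => pdt m t x :=
    (contDiff_pdt hsol.m_smooth).continuous.comp (by fun_prop : Continuous fun x : ℝ => (t, x))
  rw [integral_eq_sub_of_hasDerivAt_of_le hL.le
    (fun x _ => (hd x).continuousAt.continuousWithinAt)
    (fun x hx => (hd x).congr_deriv (hsol.fp_expanded ht hx).symm) (hint.intervalIntegrable _ _),
    hsol.m_flux t ht', hsol.m_bdry t ht']
  have h0 : 0 ≤ pdx m t 0 := by
    refine nonneg_of_hasDerivAt_of_forall_Icc_right_le hL (hasDerivAt_pdx hsol.m_smooth t 0)
      fun x hx => ?_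
    rw [hsol.m_bdry t ht']
    exact hsol.m_nonneg hdata ht' hx
  have : 0 ≤ σ ^ 2 / 2 * pdx m t 0 := mul_nonneg (by positivity) h0
  linarith

theorem continuous_integral_pdt (hu : ContDiff ℝ (⊤ : ℕ∞) (uncurry u)) (a b : ℝ) :
    Continuous fun t => ∫ x in a..b, pdt u t x :=
  intervalIntegral.continuous_parametric_intervalIntegral_of_continuous'
    (contDiff_pdt hu).continuous a b

theorem IsMFGSolution.mfgEta_le_one (hdata : MFGData T L σ r ε uT m0)
    (hsol : IsMFGSolution T L σ r ε uT m0 u m) {t : ℝ} (ht : t ∈ Icc 0 T) :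
    mfgEta L m t ≤ 1 := by
  have h1 := integral_integral_pdt hsol.m_smooth 0 t 0 L
  have h2 : ∫ s in (0:ℝ)..t, ∫ x in (0:ℝ)..L, pdt m s x ≤ ∫ s in (0:ℝ)..t, (0:ℝ) :=
    intervalIntegral.integral_mono_on_of_le_Ioo ht.1
      ((continuous_integral_pdt hsol.m_smooth 0 L).intervalIntegrable _ _)
      (continuous_const.intervalIntegrable _ _)
      fun s hs => hsol.integral_pdt_m_nonpos hdata ⟨hs.1, hs.2.trans_le ht.2⟩
  have h3 := hsol.mfgEta_zero hdata
  simp only [intervalIntegral.integral_zero] at h2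
  unfold mfgEta at h3 ⊢
  linarith

/-- Evolution of the pairing `∫ u m` along the coupled system. -/
theorem IsMFGSolution.integral_pdt_mul (hdata : MFGData T L σ r ε uT m0)
    (hsol : IsMFGSolution T L σ r ε uT m0 u m) {t : ℝ} (ht : t ∈ Ioo 0 T) :
    ∫ x in (0:ℝ)..L, pdt (fun t x => u t x * m t x) t x
      = r * (∫ x in (0:ℝ)..L, u t x * m t x)
        + 1 / 4 * ((∫ x in (0:ℝ)..L, m t x * (pdx u t x) ^ 2)
          - (mfgF L ε u m t) ^ 2 * mfgEta L m t) := by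
  have hL := hdata.hL
  have ht' : t ∈ Icc 0 T := ⟨ht.1.le, ht.2.le⟩
  have hsec : Continuous fun x : ℝ => (t, x) := by fun_prop
  have hcu : Continuous (u t) := hsol.u_smooth.continuous.comp hsec
  have hcm : Continuous (m t) := hsol.m_smooth.continuous.comp hsec
  have hcux : Continuous (pdx u t) := (contDiff_pdx hsol.u_smooth).continuous.comp hsec
  have hcum : Continuous (pdt (fun t x => u t x * m t x) t) :=
    (contDiff_pdt (u := fun t x => u t x * m t x)
      (hsol.u_smooth.mul hsol.m_smooth)).continuous.comp hsec
  set f := mfgF L ε u m t with hf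
  have hd : ∀ x, HasDerivAt (fun x => u t x * (σ ^ 2 / 2 * pdx m t x + mfgG L ε u m t x * m t x)
        - σ ^ 2 / 2 * pdx u t x * m t x)
      (pdx u t x * (σ ^ 2 / 2 * pdx m t x + mfgG L ε u m t x * m t x)
        + u t x * (σ ^ 2 / 2 * pdxx m t x
          + (-(1 / 2) * pdxx u t x * m t x + mfgG L ε u m t x * pdx m t x))
        - (σ ^ 2 / 2 * pdxx u t x * m t x + σ ^ 2 / 2 * pdx u t x * pdx m t x)) x := fun x =>
    ((hasDerivAt_pdx hsol.u_smooth t x).fun_mul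
      (((hasDerivAt_pdxx hsol.m_smooth t x).const_mul _).fun_add
        ((hasDerivAt_mfgG hsol.u_smooth t x).fun_mul (hasDerivAt_pdx hsol.m_smooth t x)))).fun_sub
      (((hasDerivAt_pdxx hsol.u_smooth t x).const_mul _).fun_mul
        (hasDerivAt_pdx hsol.m_smooth t x))
  have hd' : ∀ x ∈ Ioo 0 L,
      HasDerivAt (fun x => u t x * (σ ^ 2 / 2 * pdx m t x + mfgG L ε u m t x * m t x)
        - σ ^ 2 / 2 * pdx u t x * m t x)
      (pdt (fun t x => u t x * m t x) t x - r * (u t x * m t x)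
        - 1 / 4 * (m t x * (pdx u t x) ^ 2 - f ^ 2 * m t x)) x := by
    intro x hx
    refine (hd x).congr_deriv ?_
    have hprod : pdt (fun t x => u t x * m t x) t x = pdt u t x * m t x + u t x * pdt m t x :=
      ((hasDerivAt_pdt hsol.u_smooth t x).fun_mul (hasDerivAt_pdt hsol.m_smooth t x)).deriv
    have h1 := hsol.fp_expanded ht hx
    have h2 := hsol.hjb t ht x hx
    rw [hprod, h1]
    rw [mfgH] at h2
    have h3 : mfgG L ε u m t x = 1 / 2 * (f - pdx u t x) := rfl
    have h4 : pdt u t x = r * u t x - σ ^ 2 / 2 * pdxx u t x - (mfgG L ε u m t x) ^ 2 := by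
      linarith
    rw [h4, h3]
    ring
  have hftc := integral_eq_sub_of_hasDerivAt_of_le hL.le
    (fun x _ => (hd x).continuousAt.continuousWithinAt) hd'
    (Continuous.intervalIntegrable (by fun_prop) _ _)
  rw [hsol.m_flux t ht', hsol.ux_bdry t ht', hsol.u_bdry t ht', hsol.m_bdry t ht',
    intervalIntegral.integral_sub (Continuous.intervalIntegrable (by fun_prop) _ _)
      (Continuous.intervalIntegrable (by fun_prop) _ _),
    intervalIntegral.integral_sub (Continuous.intervalIntegrable (by fun_prop) _ _)
      (Continuous.intervalIntegrable (by fun_prop) _ _),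
    intervalIntegral.integral_const_mul, intervalIntegral.integral_const_mul,
    intervalIntegral.integral_sub (Continuous.intervalIntegrable (by fun_prop) _ _)
      (Continuous.intervalIntegrable (by fun_prop) _ _),
    intervalIntegral.integral_const_mul] at hftc
  unfold mfgEta
  linarith

theorem IsMFGSolution.mfgF_sq_mul_mfgEta_le (hdata : MFGData T L σ r ε uT m0)
    (hsol : IsMFGSolution T L σ r ε uT m0 u m) {t : ℝ} (ht : t ∈ Icc 0 T) :
    (2 + ε) * ((mfgF L ε u m t) ^ 2 * mfgEta L m t)
      ≤ 2 + ε * ∫ x in (0:ℝ)..L, m t x * (pdx u t x) ^ 2 := by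
  have hL := hdata.hL
  have hsec : Continuous fun x : ℝ => (t, x) := by fun_prop
  have hcm : Continuous (m t) := hsol.m_smooth.continuous.comp hsec
  have hcux : Continuous (pdx u t) := (contDiff_pdx hsol.u_smooth).continuous.comp hsec
  have hpos := hsol.denominator_pos hdata ht
  have hη := hsol.mfgEta_le_one hdata ht
  have hfeq : mfgF L ε u m t * (2 + ε * mfgEta L m t)
      = 2 + ε * ∫ x in (0:ℝ)..L, pdx u t x * m t x := by
    rw [mfgF]
    field_simp
  generalize mfgF L ε u m t = f at hfeq ⊢
  have hsq : 0 ≤ ∫ x in (0:ℝ)..L,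
      (m t x * (pdx u t x) ^ 2 - 2 * f * (pdx u t x * m t x) + f ^ 2 * m t x) := by
    refine intervalIntegral.integral_nonneg hL.le fun x hx => ?_
    have := mul_nonneg (hsol.m_nonneg hdata ht hx) (sq_nonneg (pdx u t x - f))
    linarith
  rw [intervalIntegral.integral_add (Continuous.intervalIntegrable (by fun_prop) _ _)
      (Continuous.intervalIntegrable (by fun_prop) _ _),
    intervalIntegral.integral_sub (Continuous.intervalIntegrable (by fun_prop) _ _)
      (Continuous.intervalIntegrable (by fun_prop) _ _),
    intervalIntegral.integral_const_mul, intervalIntegral.integral_const_mul] at hsq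
  change 0 ≤ _ + f ^ 2 * mfgEta L m t at hsq
  have h1 := mul_nonneg hdata.hε hsq
  have h2 : 0 ≤ f ^ 2 * (1 - mfgEta L m t) := mul_nonneg (sq_nonneg _) (by linarith)
  have h3 := congrArg (2 * f * ·) hfeq
  nlinarith [sq_nonneg (f - 1)]

theorem IsMFGSolution.energy_le (hdata : MFGData T L σ r ε uT m0)
    (hsol : IsMFGSolution T L σ r ε uT m0 u m) {t : ℝ} (ht : t ∈ Ioo 0 T) :
    ∫ x in (0:ℝ)..L, m t x * (pdx u t x) ^ 2
      ≤ 1 + 2 * (2 + ε) * ∫ x in (0:ℝ)..L, pdt (fun t x => u t x * m t x) t x := by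
  have ht' : t ∈ Icc 0 T := ⟨ht.1.le, ht.2.le⟩
  have h1 := hsol.mfgF_sq_mul_mfgEta_le hdata ht'
  have h2 : 0 ≤ ∫ x in (0:ℝ)..L, u t x * m t x :=
    intervalIntegral.integral_nonneg hdata.hL.le fun x hx =>
      mul_nonneg (hsol.u_nonneg hdata ht hx) (hsol.m_nonneg hdata ht' hx)
  have hε : 0 ≤ 2 + ε := by linarith [hdata.hε]
  have h3 := mul_nonneg hε (mul_nonneg hdata.hr.le h2)
  rw [hsol.integral_pdt_mul hdata ht]
  linarith

theorem IsMFGSolution.integral_initial_pairing_nonneg (hdata : MFGData T L σ r ε uT m0)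
    (hsol : IsMFGSolution T L σ r ε uT m0 u m) : 0 ≤ ∫ x in (0:ℝ)..L, u 0 x * m 0 x := by
  refine intervalIntegral.integral_nonneg hdata.hL.le fun x hx =>
    mul_nonneg ?_ (hsol.m_nonneg hdata ⟨le_rfl, hdata.hT.le⟩ hx)
  have hsub : closure (Ioo 0 T) ⊆ {t | 0 ≤ u t x} :=
    closure_minimal (fun t ht => hsol.u_nonneg hdata ht hx)
      (isClosed_le continuous_const (continuous_section_left hsol.u_smooth x))
  rw [closure_Ioo hdata.hT.ne] at hsub
  exact hsub ⟨le_rfl, hdata.hT.le⟩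

theorem IsMFGSolution.integral_terminal_pairing_le (hdata : MFGData T L σ r ε uT m0)
    (hsol : IsMFGSolution T L σ r ε uT m0 u m) :
    ∫ x in (0:ℝ)..L, u T x * m T x ≤ ⨆ x : Icc (0:ℝ) L, |uT x.1| := by
  have hTT : T ∈ Icc 0 T := ⟨hdata.hT.le, le_rfl⟩
  have hsec : Continuous fun x : ℝ => (T, x) := by fun_prop
  have hcu : Continuous (u T) := hsol.u_smooth.continuous.comp hsec
  have hcm : Continuous (m T) := hsol.m_smooth.continuous.comp hsec
  have hbdd : BddAbove (range fun x : Icc (0:ℝ) L => |uT x.1|) :=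
    isCompact_range (hdata.uT_smooth.continuous.abs.comp continuous_subtype_val) |>.bddAbove
  set M := ⨆ x : Icc (0:ℝ) L, |uT x.1|
  have hM : 0 ≤ M := Real.iSup_nonneg fun x => abs_nonneg _
  calc ∫ x in (0:ℝ)..L, u T x * m T x ≤ ∫ x in (0:ℝ)..L, M * m T x := by
        refine intervalIntegral.integral_mono_on hdata.hL.le
          (Continuous.intervalIntegrable (by fun_prop) _ _)
          (Continuous.intervalIntegrable (by fun_prop) _ _) fun x hx => ?_
        rw [hsol.u_term x hx]
        exact mul_le_mul_of_nonneg_right ((le_abs_self _).trans (le_ciSup hbdd ⟨x, hx⟩))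
          (hsol.m_nonneg hdata hTT hx)
    _ = M * mfgEta L m T := intervalIntegral.integral_const_mul _ _
    _ ≤ M := mul_le_of_le_one_right hM (hsol.mfgEta_le_one hdata hTT)

end Solution

/-- the energy estimate
∫₀^T ∫₀^L m u_x² dx dt ≤ (2+ε)(1+ε)T + 4(2+ε)‖u_T‖_∞. -/
theorem mfg_energy_estimate (T L σ r ε : ℝ) (uT m0 : ℝ → ℝ)
    (hdata : MFGData T L σ r ε uT m0)
    (u m : ℝ → ℝ → ℝ) (hsol : IsMFGSolution T L σ r ε uT m0 u m) :
    (∫ t in (0:ℝ)..T, ∫ x in (0:ℝ)..L, m t x * (pdx u t x)^2)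
      ≤ (2 + ε) * (1 + ε) * T + 4 * (2 + ε) * (⨆ x : Icc (0:ℝ) L, |uT x.1|) := by
  have hT := hdata.hT
  have hε := hdata.hε
  have hsm : ContDiff ℝ (⊤ : ℕ∞) (uncurry fun t x => u t x * m t x) :=
    hsol.u_smooth.mul hsol.m_smooth
  have hD := continuous_integral_pdt hsm 0 L
  have hm : Continuous fun p : ℝ × ℝ => m p.1 p.2 := hsol.m_smooth.continuous
  have hux : Continuous fun p : ℝ × ℝ => pdx u p.1 p.2 := (contDiff_pdx hsol.u_smooth).continuous
  have hE : Continuous fun t => ∫ x in (0:ℝ)..L, m t x * (pdx u t x) ^ 2 :=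
    intervalIntegral.continuous_parametric_intervalIntegral_of_continuous'
      (f := fun t x => m t x * (pdx u t x) ^ 2)
      (show Continuous fun p : ℝ × ℝ => m p.1 p.2 * (pdx u p.1 p.2) ^ 2 by fun_prop) 0 L
  have h1 := intervalIntegral.integral_mono_on_of_le_Ioo (μ := volume)
    (g := fun t => 1 + 2 * (2 + ε) * ∫ x in (0:ℝ)..L, pdt (fun t x => u t x * m t x) t x)
    hT.le (hE.intervalIntegrable 0 T) (Continuous.intervalIntegrable (by fun_prop) 0 T)
    (fun t ht => hsol.energy_le hdata ht)
  rw [intervalIntegral.integral_add (continuous_const.intervalIntegrable _ _)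
      (Continuous.intervalIntegrable (by fun_prop) _ _),
    intervalIntegral.integral_const_mul, integral_integral_pdt hsm,
    intervalIntegral.integral_const] at h1
  simp only [sub_zero, smul_eq_mul, mul_one] at h1
  have h2 := hsol.integral_initial_pairing_nonneg hdata
  have h3 := hsol.integral_terminal_pairing_le hdata
  have hM : 0 ≤ ⨆ x : Icc (0:ℝ) L, |uT x.1| := Real.iSup_nonneg fun x => abs_nonneg _
  have hc : 0 ≤ 2 + ε := by linarith
  have h4 : 2 * (2 + ε) * ((∫ x in (0:ℝ)..L, u T x * m T x) - ∫ x in (0:ℝ)..L, u 0 x * m 0 x)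
      ≤ 2 * (2 + ε) * ⨆ x : Icc (0:ℝ) L, |uT x.1| :=
    mul_le_mul_of_nonneg_left (by linarith) (by linarith)
  have h5 : T ≤ (2 + ε) * (1 + ε) * T := le_mul_of_one_le_left hT.le (by nlinarith)
  have h6 := mul_nonneg hc hM
  linarith
end

section
/- There exists a constant C > 0, depending only on the data (u_T, m₀, L, T, σ, r, ε), such that every smooth solution (u,m) of the MFG system satisfies ∫₀^T ∫₀^L m_x(t,x)² / (m(t,x) + 1) dx dt ≤ C. -/
open Set MeasureTheory intervalIntegral Function

section Calculus

theorem hasDerivAt_intervalIntegral_of_continuous {F F' : ℝ → ℝ → ℝ} (a b : ℝ)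
    (hF : ∀ t, Continuous (F t)) (hF' : Continuous (uncurry F'))
    (hd : ∀ t x, HasDerivAt (fun s => F s x) (F' t x) t) (t : ℝ) :
    HasDerivAt (fun s => ∫ x in a..b, F s x) (∫ x in a..b, F' t x) t := by
  obtain ⟨M, hM⟩ := ((isCompact_closedBall t 1).prod isCompact_uIcc).exists_bound_of_continuousOn
    (f := uncurry F') (s := Metric.closedBall t 1 ×ˢ uIcc a b) hF'.continuousOn
  refine (intervalIntegral.hasDerivAt_integral_of_dominated_loc_of_deriv_le
    (bound := fun _ => M) (Metric.closedBall_mem_nhds t one_pos)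
    (Filter.Eventually.of_forall fun s => (hF s).aestronglyMeasurable)
    ((hF t).intervalIntegrable a b)
    (hF'.comp (Continuous.prodMk_right t)).aestronglyMeasurable
    (Filter.Eventually.of_forall fun x hx s hs => ?_) intervalIntegrable_const
    (Filter.Eventually.of_forall fun x _ s _ => hd s x)).2
  exact hM (s, x) ⟨hs, uIoc_subset_uIcc hx⟩

theorem continuous_slice {F : ℝ → ℝ → ℝ} (hF : Continuous (uncurry F)) (t : ℝ) :
    Continuous (F t) :=
  hF.comp (Continuous.prodMk_right t)

theorem hasDerivAt_time {w : ℝ → ℝ → ℝ} (hw : ContDiff ℝ (⊤ : ℕ∞) (uncurry w)) (t x : ℝ) :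
    HasDerivAt (fun s => w s x) (pdt w t x) t := by
  have h : ContDiff ℝ (⊤ : ℕ∞) (fun s => uncurry w (s, x)) := hw.comp (by fun_prop)
  exact (h.differentiable (by simp) t).hasDerivAt

theorem hasDerivAt_space {w : ℝ → ℝ → ℝ} (hw : ContDiff ℝ (⊤ : ℕ∞) (uncurry w)) (t x : ℝ) :
    HasDerivAt (w t) (pdx w t x) x := by
  have h : ContDiff ℝ (⊤ : ℕ∞) (fun y => uncurry w (t, y)) := hw.comp (by fun_prop)
  exact (h.differentiable (by simp) x).hasDerivAt

theorem contDiff_pdx_s5 {w : ℝ → ℝ → ℝ} (hw : ContDiff ℝ (⊤ : ℕ∞) (uncurry w)) :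
    ContDiff ℝ (⊤ : ℕ∞) (uncurry (pdx w)) := by
  have h : uncurry (pdx w) = fun p => fderiv ℝ (uncurry w) p (0, 1) := by
    ext ⟨t, x⟩
    have h1 := (hw.differentiable (by simp) (t, x)).hasFDerivAt.comp_hasDerivAt x
      ((hasDerivAt_const x t).prodMk (hasDerivAt_id x))
    exact (hasDerivAt_space hw t x).unique h1
  rw [h]
  exact (hw.fderiv_right (by simp)).clm_apply contDiff_const

theorem contDiff_pdt_s5 {w : ℝ → ℝ → ℝ} (hw : ContDiff ℝ (⊤ : ℕ∞) (uncurry w)) :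
    ContDiff ℝ (⊤ : ℕ∞) (uncurry (pdt w)) := by
  have h : uncurry (pdt w) = fun p => fderiv ℝ (uncurry w) p (1, 0) := by
    ext ⟨t, x⟩
    have h1 := (hw.differentiable (by simp) (t, x)).hasFDerivAt.comp_hasDerivAt t
      ((hasDerivAt_id t).prodMk (hasDerivAt_const t x))
    exact (hasDerivAt_time hw t x).unique h1
  rw [h]
  exact (hw.fderiv_right (by simp)).clm_apply contDiff_const

theorem hasDerivAt_integral_comp {w : ℝ → ℝ → ℝ} (hw : ContDiff ℝ (⊤ : ℕ∞) (uncurry w))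
    {φ φ' : ℝ → ℝ} (hφ : ∀ s, HasDerivAt φ (φ' s) s) (hφ' : Continuous φ') (L t : ℝ) :
    HasDerivAt (fun s => ∫ x in (0:ℝ)..L, φ (w s x)) (∫ x in (0:ℝ)..L, φ' (w t x) * pdt w t x)
      t := by
  have hc : Continuous φ := continuous_iff_continuousAt.2 fun s => (hφ s).continuousAt
  refine hasDerivAt_intervalIntegral_of_continuous (F' := fun t x => φ' (w t x) * pdt w t x) 0 L
    (fun s => hc.comp (continuous_slice hw.continuous s))
    ((hφ'.comp hw.continuous).mul (contDiff_pdt_s5 hw).continuous) (fun s x => ?_) t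
  exact (hφ (w s x)).comp s (hasDerivAt_time hw s x)

theorem hasDerivAt_integral_mul {v w : ℝ → ℝ → ℝ} (hv : ContDiff ℝ (⊤ : ℕ∞) (uncurry v))
    (hw : ContDiff ℝ (⊤ : ℕ∞) (uncurry w)) (L t : ℝ) :
    HasDerivAt (fun s => ∫ x in (0:ℝ)..L, v s x * w s x)
      ((∫ x in (0:ℝ)..L, w t x * pdt v t x) + ∫ x in (0:ℝ)..L, v t x * pdt w t x) t := by
  have cv := hv.continuous
  have cw := hw.continuous
  have cv' := (contDiff_pdt_s5 hv).continuous
  have cw' := (contDiff_pdt_s5 hw).continuous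
  rw [← intervalIntegral.integral_add (f := fun x => w t x * pdt v t x)
    (g := fun x => v t x * pdt w t x)
    (((continuous_slice cw t).mul (continuous_slice cv' t)).intervalIntegrable _ _)
    (((continuous_slice cv t).mul (continuous_slice cw' t)).intervalIntegrable _ _)]
  refine hasDerivAt_intervalIntegral_of_continuous
    (F' := fun t x => w t x * pdt v t x + v t x * pdt w t x) 0 L
    (fun s => (continuous_slice cv s).mul (continuous_slice cw s))
    ((cw.mul cv').add (cv.mul cw')) (fun s x => ?_) t
  exact ((hasDerivAt_time hv s x).mul (hasDerivAt_time hw s x)).congr_deriv (by ring)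

theorem antitoneOn_Icc_of_hasDerivAt_nonpos {y y' : ℝ → ℝ} {T : ℝ}
    (hy : ∀ t, HasDerivAt y (y' t) t) (h : ∀ t ∈ Ioo 0 T, y' t ≤ 0) :
    AntitoneOn y (Icc 0 T) := by
  refine antitoneOn_of_deriv_nonpos (convex_Icc 0 T)
    (fun t _ => (hy t).continuousAt.continuousWithinAt)
    (fun t _ => (hy t).differentiableAt.differentiableWithinAt) fun t ht => ?_
  rw [interior_Icc] at ht
  rw [(hy t).deriv]
  exact h t ht

theorem eq_zero_of_integral_nonpos {g : ℝ → ℝ} {L : ℝ} (hL : 0 < L) (hg : Continuous g)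
    (h0 : ∀ x, 0 ≤ g x) (hi : ∫ x in (0:ℝ)..L, g x ≤ 0) : ∀ x ∈ Icc 0 L, g x = 0 := by
  intro x hx
  by_contra hne
  exact hi.not_gt (intervalIntegral.integral_pos hL hg.continuousOn (fun y _ => h0 y)
    ⟨x, hx, (h0 x).lt_of_ne' hne⟩)

theorem hasDerivAt_min_zero_pow (n : ℕ) (s : ℝ) :
    HasDerivAt (fun s : ℝ => (min s 0) ^ (n + 2)) ((n + 2) * (min s 0) ^ (n + 1)) s := by
  rcases lt_trichotomy s 0 with h | rfl | h
  · have h1 := hasDerivAt_pow (n + 2) s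
    rw [min_eq_left h.le]
    refine HasDerivAt.congr_of_eventuallyEq (by simpa using h1) ?_
    filter_upwards [gt_mem_nhds h] with y hy
    rw [min_eq_left hy.le]
  · simp only [min_self, ne_eq, Nat.add_eq_zero_iff, one_ne_zero, and_false, not_false_eq_true,
      zero_pow, mul_zero]
    rw [hasDerivAt_iff_isLittleO_nhds_zero]
    simp only [zero_add, min_self, smul_zero, sub_zero, ne_eq, Nat.add_eq_zero_iff,
      OfNat.ofNat_ne_zero, and_false, not_false_eq_true, zero_pow]
    refine Asymptotics.IsBigO.trans_isLittleO (g := fun h : ℝ => h ^ (n + 2)) ?_ ?_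
    · refine Asymptotics.IsBigO.of_bound 1 (Filter.Eventually.of_forall fun h => ?_)
      rw [norm_pow, norm_pow, one_mul]
      refine pow_le_pow_left₀ (norm_nonneg _) ?_ _
      rcases le_total h 0 with hh | hh
      · rw [min_eq_left hh]
      · rw [min_eq_right hh]; simp
    · simpa using Asymptotics.isLittleO_pow_pow (𝕜 := ℝ) (show 1 < n + 2 by omega)
  · rw [min_eq_right h.le]
    refine HasDerivAt.congr_of_eventuallyEq (f := fun _ => (0:ℝ))
      (by simpa using hasDerivAt_const s (0:ℝ)) ?_
    filter_upwards [lt_mem_nhds h] with y hy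
    rw [min_eq_right hy.le]
    simp

theorem hasDerivAt_min_zero_cube (s : ℝ) :
    HasDerivAt (fun s : ℝ => (min s 0) ^ 3) (3 * (min s 0) ^ 2) s := by
  convert hasDerivAt_min_zero_pow 1 s using 1
  norm_num

theorem hasDerivAt_min_zero_sq (s : ℝ) :
    HasDerivAt (fun s : ℝ => (min s 0) ^ 2) (2 * min s 0) s := by
  simpa using hasDerivAt_min_zero_pow 0 s

theorem min_zero_mul_self (s : ℝ) : min s 0 * s = (min s 0) ^ 2 := by
  rcases le_total s 0 with h | h
  · rw [min_eq_left h, sq]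
  · simp [min_eq_right h]

theorem nonneg_of_min_zero_cube {s : ℝ} (h : -(min s 0) ^ 3 = 0) : 0 ≤ s :=
  min_eq_right_iff.1 (pow_eq_zero_iff (by norm_num) |>.1 (neg_eq_zero.1 h))

theorem deriv_nonneg_of_nonneg_right {g : ℝ → ℝ} {d L : ℝ} (hL : 0 < L)
    (hg : HasDerivAt g d 0) (h0 : g 0 = 0) (hpos : ∀ x ∈ Icc 0 L, 0 ≤ g x) : 0 ≤ d := by
  refine ge_of_tendsto hg.tendsto_slope_zero_right ?_
  filter_upwards [Ioo_mem_nhdsGT hL] with x hx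
  simpa [h0] using mul_nonneg (inv_nonneg.2 hx.1.le) (hpos x ⟨hx.1.le, hx.2.le⟩)

theorem hasDerivAt_mul_arsinh_sub_sqrt (s : ℝ) :
    HasDerivAt (fun s => s * Real.arsinh s - √(1 + s ^ 2)) (Real.arsinh s) s := by
  have hpos : 0 < 1 + s ^ 2 := by positivity
  refine (((hasDerivAt_id s).mul (Real.hasDerivAt_arsinh s)).sub
    (((hasDerivAt_pow 2 s).const_add 1).sqrt hpos.ne')).congr_deriv ?_
  have := (Real.sqrt_pos.2 hpos).ne'
  simp
  field_simp
  ring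

end Calculus

section Solution

variable {T L σ r ε : ℝ} {uT m0 : ℝ → ℝ} {u m : ℝ → ℝ → ℝ}

theorem continuous_mfgG (hu : ContDiff ℝ (⊤ : ℕ∞) (uncurry u)) (t : ℝ) :
    Continuous (mfgG L ε u m t) :=
  continuous_iff_continuousAt.2 fun x => (hasDerivAt_mfgG hu t x).continuousAt

namespace IsMFGSolution

theorem hjb_Icc (h : IsMFGSolution T L σ r ε uT m0 u m) (hL : 0 < L) {t : ℝ}
    (ht : t ∈ Ioo 0 T) {x : ℝ} (hx : x ∈ Icc 0 L) :
    pdt u t x = -(σ ^ 2 / 2) * pdxx u t x + r * u t x - mfgG L ε u m t x ^ 2 := by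
  have cu := continuous_slice h.u_smooth.continuous t
  have cut := continuous_slice (contDiff_pdt_s5 h.u_smooth).continuous t
  have cuxx : Continuous (pdxx u t) :=
    continuous_slice (contDiff_pdx_s5 (contDiff_pdx_s5 h.u_smooth)).continuous t
  have cG := continuous_mfgG (L := L) (ε := ε) (m := m) h.u_smooth t
  have key : EqOn (pdt u t)
      (fun x => -(σ ^ 2 / 2) * pdxx u t x + r * u t x - mfgG L ε u m t x ^ 2) (Ioo 0 L) := by
    intro y hy
    have := h.hjb t ht y hy
    simp only [mfgH] at this ⊢
    linarith
  have := key.closure cut (by fun_prop)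
  rw [closure_Ioo hL.ne] at this
  exact this hx

theorem hasDerivAt_flux (h : IsMFGSolution T L σ r ε uT m0 u m) (hL : 0 < L) {t : ℝ}
    (ht : t ∈ Ioo 0 T) {x : ℝ} (hx : x ∈ Icc 0 L) :
    HasDerivAt (fun y => σ ^ 2 / 2 * pdx m t y + mfgG L ε u m t y * m t y) (pdt m t x) x := by
  have cm := continuous_slice h.m_smooth.continuous t
  have cmt := continuous_slice (contDiff_pdt_s5 h.m_smooth).continuous t
  have cmx := continuous_slice (contDiff_pdx_s5 h.m_smooth).continuous t
  have cmxx : Continuous (pdxx m t) :=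
    continuous_slice (contDiff_pdx_s5 (contDiff_pdx_s5 h.m_smooth)).continuous t
  have cuxx : Continuous (pdxx u t) :=
    continuous_slice (contDiff_pdx_s5 (contDiff_pdx_s5 h.u_smooth)).continuous t
  have cG := continuous_mfgG (L := L) (ε := ε) (m := m) h.u_smooth t
  have hGm : ∀ y, HasDerivAt (fun y => mfgG L ε u m t y * m t y)
      (-(1 / 2) * pdxx u t y * m t y + mfgG L ε u m t y * pdx m t y) y := fun y =>
    (hasDerivAt_mfgG h.u_smooth t y).mul (hasDerivAt_space h.m_smooth t y)
  have key : EqOn (pdt m t) (fun y => σ ^ 2 / 2 * pdxx m t y +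
      (-(1 / 2) * pdxx u t y * m t y + mfgG L ε u m t y * pdx m t y)) (Ioo 0 L) := by
    intro y hy
    have := h.fp t ht y hy
    rw [(hGm y).deriv] at this
    linarith
  have := key.closure cmt (by fun_prop)
  rw [closure_Ioo hL.ne] at this
  rw [this hx]
  exact ((hasDerivAt_space (contDiff_pdx_s5 h.m_smooth) t x).const_mul _).add (hGm x)

theorem integral_mul_pdt_m (h : IsMFGSolution T L σ r ε uT m0 u m) (hL : 0 < L) {t : ℝ}
    (ht : t ∈ Ioo 0 T) {ψ ψ' : ℝ → ℝ} (hψ : ∀ x, HasDerivAt ψ (ψ' x) x) (hψ' : Continuous ψ') :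
    ∫ x in (0:ℝ)..L, ψ x * pdt m t x = -(ψ 0 * (σ ^ 2 / 2 * pdx m t 0)) -
      ∫ x in (0:ℝ)..L, ψ' x * (σ ^ 2 / 2 * pdx m t x + mfgG L ε u m t x * m t x) := by
  have ht' : t ∈ Icc 0 T := Ioo_subset_Icc_self ht
  rw [intervalIntegral.integral_mul_deriv_eq_deriv_mul (fun x _ => hψ x)
    (fun x hx => h.hasDerivAt_flux hL ht (uIcc_of_le hL.le ▸ hx)) (hψ'.intervalIntegrable _ _)
    ((continuous_slice (contDiff_pdt_s5 h.m_smooth).continuous t).intervalIntegrable _ _),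
    h.m_flux t ht', h.m_bdry t ht']
  ring

theorem integral_mul_pdt_u (h : IsMFGSolution T L σ r ε uT m0 u m) (hL : 0 < L) {t : ℝ}
    (ht : t ∈ Ioo 0 T) {ψ ψ' : ℝ → ℝ} (hψ : ∀ x, HasDerivAt ψ (ψ' x) x) (hψ' : Continuous ψ')
    (hψ0 : ψ 0 = 0) :
    ∫ x in (0:ℝ)..L, ψ x * pdt u t x = ∫ x in (0:ℝ)..L,
      (σ ^ 2 / 2 * (ψ' x * pdx u t x) + ψ x * (r * u t x - mfgG L ε u m t x ^ 2)) := by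
  have ht' : t ∈ Icc 0 T := Ioo_subset_Icc_self ht
  have cψ : Continuous ψ := continuous_iff_continuousAt.2 fun x => (hψ x).continuousAt
  have cu := continuous_slice h.u_smooth.continuous t
  have cux := continuous_slice (contDiff_pdx_s5 h.u_smooth).continuous t
  have cuxx : Continuous (pdxx u t) :=
    continuous_slice (contDiff_pdx_s5 (contDiff_pdx_s5 h.u_smooth)).continuous t
  have cG := continuous_mfgG (L := L) (ε := ε) (m := m) h.u_smooth t
  have ibp := intervalIntegral.integral_mul_deriv_eq_deriv_mul (a := 0) (b := L) (fun x _ => hψ x)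
    (fun x _ => hasDerivAt_space (contDiff_pdx_s5 h.u_smooth) t x) (hψ'.intervalIntegrable _ _)
    (cuxx.intervalIntegrable _ _)
  rw [h.ux_bdry t ht', hψ0, mul_zero, zero_mul, sub_zero, zero_sub] at ibp
  have e : ∫ x in (0:ℝ)..L, ψ x * pdt u t x = ∫ x in (0:ℝ)..L,
      (-(σ ^ 2 / 2) * (ψ x * pdx (pdx u) t x) + ψ x * (r * u t x - mfgG L ε u m t x ^ 2)) := by
    refine intervalIntegral.integral_congr fun x hx => ?_
    rw [h.hjb_Icc hL ht (uIcc_of_le hL.le ▸ hx)]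
    rw [show pdx (pdx u) t x = pdxx u t x from rfl]
    ring
  have cuxx' : Continuous (pdx (pdx u) t) := cuxx
  rw [e, intervalIntegral.integral_add, intervalIntegral.integral_add,
    intervalIntegral.integral_const_mul, intervalIntegral.integral_const_mul, ibp]
  · ring
  all_goals exact Continuous.intervalIntegrable (by fun_prop) _ _

theorem exists_bound_mfgG_sq (h : IsMFGSolution T L σ r ε uT m0 u m) (hL : 0 < L) :
    ∃ K, ∀ t ∈ Ioo 0 T, ∀ x ∈ Icc 0 L, mfgG L ε u m t x ^ 2 ≤ K := by
  have cu := h.u_smooth.continuous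
  have cut := (contDiff_pdt_s5 h.u_smooth).continuous
  have cuxx : Continuous (uncurry (pdxx u)) := (contDiff_pdx_s5 (contDiff_pdx_s5 h.u_smooth)).continuous
  have c : Continuous fun p : ℝ × ℝ => -(σ ^ 2 / 2) * uncurry (pdxx u) p + r * uncurry u p
      - uncurry (pdt u) p := by fun_prop
  obtain ⟨K, hK⟩ := (isCompact_Icc.prod isCompact_Icc).exists_bound_of_continuousOn
    (s := Icc 0 T ×ˢ Icc 0 L) c.continuousOn
  refine ⟨K, fun t ht x hx => ?_⟩
  have h1 := (le_abs_self _).trans (hK (t, x) ⟨Ioo_subset_Icc_self ht, hx⟩)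
  have h2 := h.hjb_Icc hL ht hx
  simp only [uncurry] at h1
  linarith

theorem m_nonneg_s5 (h : IsMFGSolution T L σ r ε uT m0 u m) (hd : MFGData T L σ r ε uT m0) :
    ∀ t ∈ Icc 0 T, ∀ x ∈ Icc 0 L, 0 ≤ m t x := by
  obtain ⟨K, hK⟩ := h.exists_bound_mfgG_sq hd.hL
  have hσ := hd.hσ
  set c := 3 / σ ^ 2 * K with hc
  set y : ℝ → ℝ := fun t => ∫ x in (0:ℝ)..L, (min (m t x) 0) ^ 3 with hy
  have hy' := fun t => hasDerivAt_integral_comp h.m_smooth hasDerivAt_min_zero_cube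
    (by fun_prop) L t
  have hexp : ∀ t, HasDerivAt (fun t => -Real.exp (-c * t)) (c * Real.exp (-c * t)) t := by
    intro t
    exact ((hasDerivAt_id t).const_mul (-c)).exp.neg.congr_deriv (by simp only [id]; ring)
  have anti := antitoneOn_Icc_of_hasDerivAt_nonpos (T := T) (fun t => (hexp t).mul (hy' t)) (by
    intro t ht
    have cm := continuous_slice h.m_smooth.continuous t
    have cmx := continuous_slice (contDiff_pdx_s5 h.m_smooth).continuous t
    have cG := continuous_mfgG (L := L) (ε := ε) (m := m) h.u_smooth t
    have hψ : ∀ x, HasDerivAt (fun x => 3 * (min (m t x) 0) ^ 2)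
        (3 * (2 * min (m t x) 0 * pdx m t x)) x := fun x =>
      ((hasDerivAt_min_zero_sq (m t x)).comp x (hasDerivAt_space h.m_smooth t x)).const_mul 3
    have e := h.integral_mul_pdt_m hd.hL ht hψ (by fun_prop)
    rw [h.m_bdry t (Ioo_subset_Icc_self ht)] at e
    have le : c * y t ≤ ∫ x in (0:ℝ)..L, 3 * (min (m t x) 0) ^ 2 * pdt m t x := by
      rw [e]
      simp only [min_self, ne_eq, OfNat.ofNat_ne_zero, not_false_eq_true, zero_pow, mul_zero,
        zero_mul, neg_zero, zero_sub]
      rw [← intervalIntegral.integral_neg, hy, ← intervalIntegral.integral_const_mul]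
      refine intervalIntegral.integral_mono_on hd.hL.le
        (Continuous.intervalIntegrable (by fun_prop) _ _)
        (Continuous.intervalIntegrable (by fun_prop) _ _) fun x hx => ?_
      have hn := min_zero_mul_self (m t x)
      have hn0 := min_le_right (m t x) 0
      have hG := hK t ht x hx
      set n := min (m t x) 0
      set G := mfgG L ε u m t x
      set p := pdx m t x
      have h3 : 0 ≤ -n ^ 3 := by
        have : 0 ≤ (-n) ^ 3 := pow_nonneg (by linarith) 3
        linarith [show (-n) ^ 3 = -n ^ 3 by ring]
      have h4 : 3 / σ ^ 2 * G ^ 2 * (-n ^ 3) ≤ c * (-n ^ 3) := by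
        rw [hc]; gcongr
      have h5 : -(3 * (2 * n * p) * (σ ^ 2 / 2 * p + G * m t x))
          = 3 / σ ^ 2 * G ^ 2 * n ^ 3 + 3 * (-n) * (σ * p + n * G / σ) ^ 2 := by
        have : -(3 * (2 * n * p) * (σ ^ 2 / 2 * p + G * m t x))
          = -(3 * (2 * n * p) * (σ ^ 2 / 2 * p)) - 6 * p * G * (n * m t x) := by ring
        rw [this, hn]
        field_simp
        ring
      rw [h5]
      have : 0 ≤ 3 * (-n) * (σ * p + n * G / σ) ^ 2 :=
        mul_nonneg (by linarith) (sq_nonneg _)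
      linarith
    have hpos := Real.exp_pos (-c * t)
    nlinarith [mul_le_mul_of_nonneg_left le hpos.le])
  intro t ht
  have h1 := anti ⟨le_rfl, hd.hT.le⟩ ht ht.1
  have h0 : ∫ x in (0:ℝ)..L, (min (m 0 x) 0) ^ 3 = 0 := by
    rw [intervalIntegral.integral_congr (g := fun _ => 0), intervalIntegral.integral_zero]
    intro x hx
    rw [uIcc_of_le hd.hL.le] at hx
    simp [h.m_init x hx, hd.m0_nonneg x hx]
  simp only [Pi.mul_apply, h0, mul_zero] at h1
  have h2 : 0 ≤ ∫ x in (0:ℝ)..L, (min (m t x) 0) ^ 3 := by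
    by_contra! hneg
    nlinarith [mul_pos_of_neg_of_neg (neg_neg_of_pos (Real.exp_pos (-c * t))) hneg]
  have cm := continuous_slice h.m_smooth.continuous t
  intro x hx
  refine nonneg_of_min_zero_cube (eq_zero_of_integral_nonpos hd.hL
    (g := fun x => -(min (m t x) 0) ^ 3) (by fun_prop) (fun x => ?_) ?_ x hx)
  · rw [← Odd.neg_pow (by decide)]
    exact pow_nonneg (neg_nonneg.2 (min_le_right _ _)) 3
  · rw [intervalIntegral.integral_neg]
    linarith

theorem u_nonneg_s5 (h : IsMFGSolution T L σ r ε uT m0 u m) (hd : MFGData T L σ r ε uT m0) :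
    ∀ t ∈ Icc 0 T, ∀ x ∈ Icc 0 L, 0 ≤ u t x := by
  have hr := hd.hr
  have anti := antitoneOn_Icc_of_hasDerivAt_nonpos (T := T)
    (fun t => hasDerivAt_integral_comp h.u_smooth hasDerivAt_min_zero_cube (by fun_prop) L t) (by
    intro t ht
    have cu := continuous_slice h.u_smooth.continuous t
    have hψ : ∀ x, HasDerivAt (fun x => 3 * (min (u t x) 0) ^ 2)
        (3 * (2 * min (u t x) 0 * pdx u t x)) x := fun x =>
      ((hasDerivAt_min_zero_sq (u t x)).comp x (hasDerivAt_space h.u_smooth t x)).const_mul 3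
    have cux := continuous_slice (contDiff_pdx_s5 h.u_smooth).continuous t
    rw [h.integral_mul_pdt_u hd.hL ht hψ (by fun_prop)
      (by simp [h.u_bdry t (Ioo_subset_Icc_self ht)])]
    rw [← neg_nonneg, ← intervalIntegral.integral_neg]
    refine intervalIntegral.integral_nonneg hd.hL.le fun x hx => neg_nonneg.2 ?_
    have hn := min_zero_mul_self (u t x)
    have hn0 := min_le_right (u t x) 0
    set n := min (u t x) 0
    set G := mfgG L ε u m t x
    set p := pdx u t x
    have e : σ ^ 2 / 2 * (3 * (2 * n * p) * p) + 3 * n ^ 2 * (r * u t x - G ^ 2)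
        = n * (3 * (σ * p) ^ 2) + 3 * r * n * (n * u t x) - 3 * (n * G) ^ 2 := by ring
    rw [e, hn]
    have e1 : n * (3 * (σ * p) ^ 2) ≤ 0 := mul_nonpos_of_nonpos_of_nonneg hn0 (by positivity)
    have e2 : 3 * r * n * n ^ 2 ≤ 0 :=
      mul_nonpos_of_nonpos_of_nonneg (mul_nonpos_of_nonneg_of_nonpos (by positivity) hn0)
        (by positivity)
    nlinarith [sq_nonneg (n * G)])
  intro t ht
  have h1 := anti ht ⟨hd.hT.le, le_rfl⟩ ht.2
  have h0 : ∫ x in (0:ℝ)..L, (min (u T x) 0) ^ 3 = 0 := by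
    rw [intervalIntegral.integral_congr (g := fun _ => 0), intervalIntegral.integral_zero]
    intro x hx
    rw [uIcc_of_le hd.hL.le] at hx
    simp [h.u_term x hx, hd.uT_nonneg x hx]
  simp only [h0] at h1
  have cu := continuous_slice h.u_smooth.continuous t
  intro x hx
  refine nonneg_of_min_zero_cube (eq_zero_of_integral_nonpos hd.hL
    (g := fun x => -(min (u t x) 0) ^ 3) (by fun_prop) (fun x => ?_) ?_ x hx)
  · rw [← Odd.neg_pow (by decide)]
    exact pow_nonneg (neg_nonneg.2 (min_le_right _ _)) 3
  · rw [intervalIntegral.integral_neg]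
    linarith

theorem mfgEta_nonneg (h : IsMFGSolution T L σ r ε uT m0 u m) (hd : MFGData T L σ r ε uT m0)
    {t : ℝ} (ht : t ∈ Icc 0 T) : 0 ≤ mfgEta L m t :=
  intervalIntegral.integral_nonneg hd.hL.le (h.m_nonneg_s5 hd t ht)

theorem mfgEta_le_one_s5 (h : IsMFGSolution T L σ r ε uT m0 u m) (hd : MFGData T L σ r ε uT m0)
    {t : ℝ} (ht : t ∈ Icc 0 T) : mfgEta L m t ≤ 1 := by
  have anti := antitoneOn_Icc_of_hasDerivAt_nonpos (T := T)
    (fun t => hasDerivAt_integral_comp (φ := fun s => s) h.m_smooth (fun s => hasDerivAt_id s)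
      continuous_const L t) (by
    intro t ht
    have ht' := Ioo_subset_Icc_self ht
    rw [h.integral_mul_pdt_m hd.hL ht (ψ := fun _ => 1) (fun x => hasDerivAt_const x 1)
      continuous_const]
    have := deriv_nonneg_of_nonneg_right hd.hL (hasDerivAt_space h.m_smooth t 0)
      (h.m_bdry t ht') (h.m_nonneg_s5 hd t ht')
    simp only [one_mul, zero_mul, intervalIntegral.integral_zero, sub_zero]
    have := mul_nonneg (by positivity : 0 ≤ σ ^ 2 / 2) this
    linarith)
  have h1 := anti ⟨le_rfl, hd.hT.le⟩ ht ht.1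
  have h0 : ∫ x in (0:ℝ)..L, m 0 x = 1 := by
    rw [← hd.m0_mass]
    exact intervalIntegral.integral_congr fun x hx => h.m_init x (uIcc_of_le hd.hL.le ▸ hx)
  exact h1.trans h0.le

theorem integral_mul_sub_sq (h : IsMFGSolution T L σ r ε uT m0 u m) (t s : ℝ) :
    ∫ x in (0:ℝ)..L, m t x * (pdx u t x - s) ^ 2 = (∫ x in (0:ℝ)..L, pdx u t x ^ 2 * m t x)
      - 2 * s * (∫ x in (0:ℝ)..L, pdx u t x * m t x) + s ^ 2 * mfgEta L m t := by
  have cm := continuous_slice h.m_smooth.continuous t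
  have cux := continuous_slice (contDiff_pdx_s5 h.u_smooth).continuous t
  rw [mfgEta, ← intervalIntegral.integral_const_mul, ← intervalIntegral.integral_const_mul,
    ← intervalIntegral.integral_sub, ← intervalIntegral.integral_add]
  · refine intervalIntegral.integral_congr fun x _ => ?_
    ring
  all_goals exact Continuous.intervalIntegrable (by fun_prop) _ _

theorem integral_mul_sub_sq_nonneg (h : IsMFGSolution T L σ r ε uT m0 u m)
    (hd : MFGData T L σ r ε uT m0) {t : ℝ} (ht : t ∈ Icc 0 T) (s : ℝ) :
    0 ≤ (∫ x in (0:ℝ)..L, pdx u t x ^ 2 * m t x)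
      - 2 * s * (∫ x in (0:ℝ)..L, pdx u t x * m t x) + s ^ 2 * mfgEta L m t := by
  rw [← h.integral_mul_sub_sq]
  exact intervalIntegral.integral_nonneg hd.hL.le fun x hx =>
    mul_nonneg (h.m_nonneg_s5 hd t ht x hx) (sq_nonneg _)

theorem coercivity (h : IsMFGSolution T L σ r ε uT m0 u m)
    (hd : MFGData T L σ r ε uT m0) {t : ℝ} (ht : t ∈ Icc 0 T) :
    4 / (2 + ε) ^ 2 * (∫ x in (0:ℝ)..L, pdx u t x ^ 2 * m t x) - (1 + ε / 2) ≤
      (∫ x in (0:ℝ)..L, pdx u t x ^ 2 * m t x) - mfgF L ε u m t ^ 2 * mfgEta L m t := by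
  have hε := hd.hε
  have hη := h.mfgEta_nonneg hd ht
  have hη1 := h.mfgEta_le_one_s5 hd ht
  have hs := h.integral_mul_sub_sq_nonneg hd ht
  rw [mfgF]
  set A := ∫ x in (0:ℝ)..L, pdx u t x ^ 2 * m t x
  set B := ∫ x in (0:ℝ)..L, pdx u t x * m t x
  set η := mfgEta L m t
  have hA : 0 ≤ A := by simpa using hs 0
  have hB := hs 1
  have hCS : B ^ 2 ≤ η * A := by
    have := discrim_le_zero (a := η) (b := -2 * B) (c := A) fun s => by linarith [hs s]
    rw [discrim] at this
    linarith
  have hεη : 0 ≤ ε * η := mul_nonneg hε hη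
  have hq : 0 < 2 + ε * η := by linarith
  have e : A - (2 / (2 + ε * η) + ε / (2 + ε * η) * B) ^ 2 * η
      = ((2 + ε * η) ^ 2 * A - η * (2 + ε * B) ^ 2) / (2 + ε * η) ^ 2 := by
    field_simp
  have h1 : 4 * A - (4 + 2 * ε) ≤ (2 + ε * η) ^ 2 * A - η * (2 + ε * B) ^ 2 := by
    have i1 : ε ^ 2 * η * B ^ 2 ≤ ε ^ 2 * η * (η * A) := by gcongr
    have i2 : 0 ≤ ε * η * (A - 2 * B + η) := mul_nonneg hεη (by linarith)
    have i3 : 0 ≤ ε * η * A := mul_nonneg hεη hA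
    have i4 : ε * η * η ≤ ε := by
      calc ε * η * η ≤ ε * 1 * 1 := by gcongr
        _ = ε := by ring
    nlinarith
  rw [e]
  calc 4 / (2 + ε) ^ 2 * A - (1 + ε / 2)
      ≤ 4 / (2 + ε * η) ^ 2 * A - (4 + 2 * ε) / (2 + ε * η) ^ 2 := by
        refine sub_le_sub ?_ ?_
        · gcongr
          nlinarith
        · rw [div_le_iff₀ (by positivity)]
          nlinarith [mul_nonneg hεη (by linarith : 0 ≤ 4 + ε * η)]
    _ = (4 * A - (4 + 2 * ε)) / (2 + ε * η) ^ 2 := by ring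
    _ ≤ _ := by gcongr

theorem integral_mfgG_sq_mul_le (h : IsMFGSolution T L σ r ε uT m0 u m)
    (hd : MFGData T L σ r ε uT m0) {t : ℝ} (ht : t ∈ Icc 0 T) :
    ∫ x in (0:ℝ)..L, mfgG L ε u m t x ^ 2 * m t x ≤
      (∫ x in (0:ℝ)..L, pdx u t x ^ 2 * m t x) + (1 + ε / 2) := by
  have hε := hd.hε
  have e : ∫ x in (0:ℝ)..L, mfgG L ε u m t x ^ 2 * m t x =
      1 / 4 * ∫ x in (0:ℝ)..L, m t x * (pdx u t x - mfgF L ε u m t) ^ 2 := by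
    rw [← intervalIntegral.integral_const_mul]
    refine intervalIntegral.integral_congr fun x _ => ?_
    simp only [mfgG]
    ring
  have hA : 0 ≤ ∫ x in (0:ℝ)..L, pdx u t x ^ 2 * m t x := by
    simpa using h.integral_mul_sub_sq_nonneg hd ht 0
  have hA' := mul_nonneg (by positivity : 0 ≤ 4 / (2 + ε) ^ 2) hA
  have hc := h.coercivity hd ht
  have hs := h.integral_mul_sub_sq_nonneg hd ht (-mfgF L ε u m t)
  rw [e, h.integral_mul_sub_sq]
  linarith

theorem integral_arsinh_mul_pdt_le (h : IsMFGSolution T L σ r ε uT m0 u m)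
    (hd : MFGData T L σ r ε uT m0) {t : ℝ} (ht : t ∈ Ioo 0 T) :
    ∫ x in (0:ℝ)..L, Real.arsinh (m t x) * pdt m t x ≤
      -(σ ^ 2 / 4) * (∫ x in (0:ℝ)..L, pdx m t x ^ 2 / √(1 + m t x ^ 2)) +
      1 / σ ^ 2 * ∫ x in (0:ℝ)..L, mfgG L ε u m t x ^ 2 * m t x := by
  have hσ := hd.hσ
  have ht' := Ioo_subset_Icc_self ht
  have cm := continuous_slice h.m_smooth.continuous t
  have cmx := continuous_slice (contDiff_pdx_s5 h.m_smooth).continuous t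
  have cG := continuous_mfgG (L := L) (ε := ε) (m := m) h.u_smooth t
  have hq : ∀ x, 0 < √(1 + m t x ^ 2) := fun x => Real.sqrt_pos.2 (by positivity)
  have hq' : ∀ x, √(1 + m t x ^ 2) ≠ 0 := fun x => (hq x).ne'
  have cq : Continuous fun x => (√(1 + m t x ^ 2))⁻¹ := (by fun_prop : Continuous _).inv₀ hq'
  have hψ : ∀ x, HasDerivAt (fun x => Real.arsinh (m t x))
      ((√(1 + m t x ^ 2))⁻¹ * pdx m t x) x := fun x =>
    (Real.hasDerivAt_arsinh (m t x)).comp x (hasDerivAt_space h.m_smooth t x)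
  rw [h.integral_mul_pdt_m hd.hL ht hψ (by fun_prop), h.m_bdry t ht', Real.arsinh_zero, zero_mul,
    neg_zero, zero_sub, ← intervalIntegral.integral_neg, ← intervalIntegral.integral_const_mul,
    ← intervalIntegral.integral_const_mul, ← intervalIntegral.integral_add]
  rotate_left
  · exact Continuous.intervalIntegrable (by simp only [div_eq_mul_inv]; fun_prop) _ _
  · exact Continuous.intervalIntegrable (by fun_prop) _ _
  refine intervalIntegral.integral_mono_on hd.hL.le
    (Continuous.intervalIntegrable (by fun_prop) _ _)
    (Continuous.intervalIntegrable (by simp only [div_eq_mul_inv]; fun_prop) _ _) fun x hx => ?_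
  have hm := h.m_nonneg_s5 hd t ht' x hx
  have hmq : m t x ≤ √(1 + m t x ^ 2) := Real.le_sqrt_of_sq_le (by linarith)
  have hqx := hq x
  set q := √(1 + m t x ^ 2)
  set μ := m t x
  set p := pdx m t x
  set G := mfgG L ε u m t x
  have e : -(q⁻¹ * p * (σ ^ 2 / 2 * p + G * μ)) = -(σ ^ 2 / 4) * (p ^ 2 / q)
      + 1 / σ ^ 2 * (G ^ 2 * (μ ^ 2 / q)) - (σ * p / 2 + G * μ / σ) ^ 2 / q := by
    field_simp
    ring
  have h1 : μ ^ 2 / q ≤ μ := by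
    rw [div_le_iff₀ hqx, sq]
    gcongr
  have h2 : 1 / σ ^ 2 * (G ^ 2 * (μ ^ 2 / q)) ≤ 1 / σ ^ 2 * (G ^ 2 * μ) := by gcongr
  have h3 : 0 ≤ (σ * p / 2 + G * μ / σ) ^ 2 / q := by positivity
  rw [e]
  linarith

theorem integral_pdt_u_mul_add (h : IsMFGSolution T L σ r ε uT m0 u m)
    (hd : MFGData T L σ r ε uT m0) {t : ℝ} (ht : t ∈ Ioo 0 T) :
    (∫ x in (0:ℝ)..L, m t x * pdt u t x) + ∫ x in (0:ℝ)..L, u t x * pdt m t x =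
      r * (∫ x in (0:ℝ)..L, u t x * m t x) + 1 / 4 *
        ((∫ x in (0:ℝ)..L, pdx u t x ^ 2 * m t x) - mfgF L ε u m t ^ 2 * mfgEta L m t) := by
  have ht' := Ioo_subset_Icc_self ht
  have cm := continuous_slice h.m_smooth.continuous t
  have cu := continuous_slice h.u_smooth.continuous t
  have cmx := continuous_slice (contDiff_pdx_s5 h.m_smooth).continuous t
  have cux := continuous_slice (contDiff_pdx_s5 h.u_smooth).continuous t
  have cG := continuous_mfgG (L := L) (ε := ε) (m := m) h.u_smooth t
  rw [h.integral_mul_pdt_u hd.hL ht (hasDerivAt_space h.m_smooth t) cmx (h.m_bdry t ht'),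
    h.integral_mul_pdt_m hd.hL ht (hasDerivAt_space h.u_smooth t) cux, h.u_bdry t ht', zero_mul,
    neg_zero, zero_sub, ← sub_eq_add_neg, ← intervalIntegral.integral_sub, mfgEta,
    ← intervalIntegral.integral_const_mul, ← intervalIntegral.integral_const_mul,
    ← intervalIntegral.integral_sub, ← intervalIntegral.integral_const_mul,
    ← intervalIntegral.integral_add]
  · refine intervalIntegral.integral_congr fun x _ => ?_
    simp only [mfgG]
    ring
  all_goals exact Continuous.intervalIntegrable (by fun_prop) _ _

end IsMFGSolution

end Solution

theorem neg_one_add_le_mul_arsinh_sub_sqrt {s : ℝ} (hs : 0 ≤ s) :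
    -(1 + s) ≤ s * Real.arsinh s - √(1 + s ^ 2) := by
  have h1 : √(1 + s ^ 2) ≤ 1 + s := Real.sqrt_le_iff.2 ⟨by linarith, by nlinarith⟩
  have h2 := mul_nonneg hs (Real.arsinh_nonneg_iff.2 hs)
  linarith

theorem continuous_dissipation {m : ℝ → ℝ → ℝ} (hm : ContDiff ℝ (⊤ : ℕ∞) (uncurry m)) :
    Continuous (uncurry fun t x => pdx m t x ^ 2 / √(1 + m t x ^ 2)) := by
  have c1 := hm.continuous
  have c2 := (contDiff_pdx_s5 hm).continuous
  exact (c2.pow 2).div (by fun_prop : Continuous fun p => √(1 + uncurry m p ^ 2))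
    fun p => (Real.sqrt_pos.2 (by positivity)).ne'

theorem IsMFGSolution.integral_mx_sq_le_integral_dissipation {T L σ r ε : ℝ} {uT m0 : ℝ → ℝ}
    {u m : ℝ → ℝ → ℝ} (h : IsMFGSolution T L σ r ε uT m0 u m)
    (hd : MFGData T L σ r ε uT m0) :
    ∫ t in (0:ℝ)..T, ∫ x in (0:ℝ)..L, pdx m t x ^ 2 / (m t x + 1) ≤
      ∫ t in (0:ℝ)..T, ∫ x in (0:ℝ)..L, pdx m t x ^ 2 / √(1 + m t x ^ 2) := by
  have cD := continuous_dissipation h.m_smooth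
  have cI := intervalIntegral.continuous_parametric_intervalIntegral_of_continuous'
    (μ := volume) cD 0 L
  have mono : ∀ {f g : ℝ → ℝ} {b : ℝ}, 0 ≤ b → Continuous g → (∀ x ∈ Ioc 0 b, 0 ≤ f x) →
      (∀ x ∈ Ioc 0 b, f x ≤ g x) → ∫ x in (0:ℝ)..b, f x ≤ ∫ x in (0:ℝ)..b, g x := by
    intro f g b hb hg h0 hfg
    rw [intervalIntegral.integral_of_le hb, intervalIntegral.integral_of_le hb]
    exact integral_mono_of_nonneg ((ae_restrict_iff' measurableSet_Ioc).2 (.of_forall h0))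
      ((intervalIntegrable_iff_integrableOn_Ioc_of_le hb).1 (hg.intervalIntegrable _ _))
      ((ae_restrict_iff' measurableSet_Ioc).2 (.of_forall hfg))
  refine mono hd.hT.le cI (fun t ht => ?_) fun t ht => ?_
  · refine intervalIntegral.integral_nonneg hd.hL.le fun x hx => ?_
    have := h.m_nonneg_s5 hd t (Ioc_subset_Icc_self ht) x hx
    positivity
  · refine mono hd.hL.le (continuous_slice cD t) (fun x hx => ?_) fun x hx => ?_
    all_goals have hm := h.m_nonneg_s5 hd t (Ioc_subset_Icc_self ht) x (Ioc_subset_Icc_self hx)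
    · positivity
    · have hq : 0 < √(1 + m t x ^ 2) := Real.sqrt_pos.2 (by positivity)
      have : √(1 + m t x ^ 2) ≤ m t x + 1 := Real.sqrt_le_iff.2 ⟨by linarith, by nlinarith⟩
      gcongr

/-- a priori bound ∫₀^T ∫₀^L m_x²/(m+1) dx dt ≤ C with C depending
only on the data. -/
theorem mfg_mx_sq_estimate (T L σ r ε : ℝ) (uT m0 : ℝ → ℝ)
    (hdata : MFGData T L σ r ε uT m0) :
    ∃ C : ℝ, 0 < C ∧ ∀ u m : ℝ → ℝ → ℝ, IsMFGSolution T L σ r ε uT m0 u m →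
      (∫ t in (0:ℝ)..T, ∫ x in (0:ℝ)..L, (pdx m t x)^2 / (m t x + 1)) ≤ C := by
  have hT := hdata.hT
  have hL := hdata.hL
  have hσ := hdata.hσ
  have hr := hdata.hr
  have hε := hdata.hε
  obtain ⟨M, hM⟩ := isCompact_Icc.exists_bound_of_continuousOn (s := Icc 0 L)
    hdata.uT_smooth.continuous.continuousOn
  have hM0 : 0 ≤ M := (norm_nonneg _).trans (hM 0 ⟨le_rfl, hL.le⟩)
  set K := Real.exp (r * T) * (2 + ε) ^ 2 / σ ^ 2 with hK
  have hK0 : 0 ≤ K := by positivity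
  set C₁ := (1 + ε / 2) / σ ^ 2 + K * (1 + ε / 2) / 4 with hC₁
  set R := (∫ x in (0:ℝ)..L, (m0 x * Real.arsinh (m0 x) - √(1 + m0 x ^ 2)))
    + (L + 1) + K * M + C₁ * T with hR
  refine ⟨|4 / σ ^ 2 * R| + 1, by positivity, fun u m h => ?_⟩
  set D : ℝ → ℝ := fun t => ∫ x in (0:ℝ)..L, pdx m t x ^ 2 / √(1 + m t x ^ 2)
  have cD : Continuous D := intervalIntegral.continuous_parametric_intervalIntegral_of_continuous'
    (continuous_dissipation h.m_smooth) 0 L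
  have hexp : ∀ t, HasDerivAt (fun t => Real.exp (-r * t)) (-r * Real.exp (-r * t)) t := fun t =>
    ((hasDerivAt_id t).const_mul (-r)).exp.congr_deriv (by simp only [id]; ring)
  have anti := antitoneOn_Icc_of_hasDerivAt_nonpos (T := T)
    (y := fun t => (∫ x in (0:ℝ)..L, (m t x * Real.arsinh (m t x) - √(1 + m t x ^ 2)))
      - K * (Real.exp (-r * t) * ∫ x in (0:ℝ)..L, u t x * m t x)
      + σ ^ 2 / 4 * (∫ s in (0:ℝ)..t, D s) - C₁ * t)
    (fun t => (((hasDerivAt_integral_comp h.m_smooth hasDerivAt_mul_arsinh_sub_sqrt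
      Real.continuous_arsinh L t).sub
      (((hexp t).mul (hasDerivAt_integral_mul h.u_smooth h.m_smooth L t)).const_mul K)).add
      ((cD.integral_hasStrictDerivAt 0 t).hasDerivAt.const_mul _)).sub
      ((hasDerivAt_id t).const_mul C₁)) (by
    intro t ht
    have ht' := Ioo_subset_Icc_self ht
    have h1 := h.integral_arsinh_mul_pdt_le hdata ht
    have h2 := h.integral_mfgG_sq_mul_le hdata ht'
    have h3 := h.coercivity hdata ht'
    have hA : 0 ≤ ∫ x in (0:ℝ)..L, pdx u t x ^ 2 * m t x := by
      simpa using h.integral_mul_sub_sq_nonneg hdata ht' 0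
    rw [h.integral_pdt_u_mul_add hdata ht]
    change _ ≤ -(σ ^ 2 / 4) * D t + _ at h1
    set A := ∫ x in (0:ℝ)..L, pdx u t x ^ 2 * m t x
    set X := A - mfgF L ε u m t ^ 2 * mfgEta L m t
    set P := ∫ x in (0:ℝ)..L, u t x * m t x
    set g := Real.exp (-r * t) with hg
    have hg0 : 0 < g := Real.exp_pos _
    have hg1 : g ≤ 1 := Real.exp_le_one_iff.2 (by nlinarith [ht.1])
    have hgT : 1 ≤ Real.exp (r * T) * g := by
      rw [hg, ← Real.exp_add]
      exact Real.one_le_exp (by nlinarith [ht.2])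
    have h4 : K * g * (4 / (2 + ε) ^ 2 * A) = 4 / σ ^ 2 * A * (Real.exp (r * T) * g) := by
      rw [hK]
      field_simp
    have h5 : 4 / σ ^ 2 * A * 1 ≤ 4 / σ ^ 2 * A * (Real.exp (r * T) * g) := by gcongr
    have h6 := mul_le_mul_of_nonneg_left h3 (mul_nonneg hK0 hg0.le)
    have h7 : K * g * (1 + ε / 2) ≤ K * 1 * (1 + ε / 2) := by gcongr
    have h8 : 1 / σ ^ 2 * (∫ x in (0:ℝ)..L, mfgG L ε u m t x ^ 2 * m t x)
        ≤ 1 / σ ^ 2 * (A + (1 + ε / 2)) := by gcongr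
    have h9 : 4 / σ ^ 2 * A = 4 * (1 / σ ^ 2 * A) := by ring
    have h10 : (1 + ε / 2) / σ ^ 2 = 1 / σ ^ 2 * (1 + ε / 2) := by ring
    rw [hC₁, h10]
    linarith)
  have hTm : T ∈ Icc 0 T := ⟨hT.le, le_rfl⟩
  have h0m : (0:ℝ) ∈ Icc 0 T := ⟨le_rfl, hT.le⟩
  have key := anti h0m hTm hT.le
  have cm := continuous_slice h.m_smooth.continuous
  have cu := continuous_slice h.u_smooth.continuous
  have e0 : ∫ x in (0:ℝ)..L, (m 0 x * Real.arsinh (m 0 x) - √(1 + m 0 x ^ 2)) =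
      ∫ x in (0:ℝ)..L, (m0 x * Real.arsinh (m0 x) - √(1 + m0 x ^ 2)) := by
    refine intervalIntegral.integral_congr fun x hx => ?_
    rw [uIcc_of_le hL.le] at hx
    simp only [h.m_init x hx]
  have p0 : 0 ≤ ∫ x in (0:ℝ)..L, u 0 x * m 0 x :=
    intervalIntegral.integral_nonneg hL.le fun x hx =>
      mul_nonneg (h.u_nonneg_s5 hdata 0 h0m x hx) (h.m_nonneg_s5 hdata 0 h0m x hx)
  have pT : ∫ x in (0:ℝ)..L, u T x * m T x ≤ M := by
    calc ∫ x in (0:ℝ)..L, u T x * m T x ≤ ∫ x in (0:ℝ)..L, M * m T x := by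
          refine intervalIntegral.integral_mono_on hL.le
            (((cu T).mul (cm T)).intervalIntegrable _ _)
            (((cm T).const_mul M).intervalIntegrable _ _) fun x hx => ?_
          refine mul_le_mul_of_nonneg_right ?_ (h.m_nonneg_s5 hdata T hTm x hx)
          rw [h.u_term x hx]
          exact (le_abs_self _).trans (hM x hx)
      _ = M * mfgEta L m T := intervalIntegral.integral_const_mul _ _
      _ ≤ M := mul_le_of_le_one_right hM0 (h.mfgEta_le_one_s5 hdata hTm)
  have pT' : Real.exp (-r * T) * (∫ x in (0:ℝ)..L, u T x * m T x) ≤ M := by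
    have hg1 : Real.exp (-r * T) ≤ 1 := Real.exp_le_one_iff.2 (by nlinarith)
    calc _ ≤ Real.exp (-r * T) * M := by gcongr
      _ ≤ M := mul_le_of_le_one_left hM0 hg1
  have eT : -(L + 1) ≤ ∫ x in (0:ℝ)..L, (m T x * Real.arsinh (m T x) - √(1 + m T x ^ 2)) := by
    have cmT := cm T
    calc -(L + 1) ≤ -(L + mfgEta L m T) := by linarith [h.mfgEta_le_one_s5 hdata hTm]
      _ = ∫ x in (0:ℝ)..L, -(1 + m T x) := by
        rw [intervalIntegral.integral_neg, intervalIntegral.integral_add intervalIntegrable_const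
          (cmT.intervalIntegrable _ _), mfgEta]
        simp
      _ ≤ _ := intervalIntegral.integral_mono_on hL.le
        (Continuous.intervalIntegrable (by fun_prop) _ _)
        (Continuous.intervalIntegrable
          ((cmT.mul (Real.continuous_arsinh.comp cmT)).sub (by fun_prop)) _ _)
        fun x hx => neg_one_add_le_mul_arsinh_sub_sqrt (h.m_nonneg_s5 hdata T hTm x hx)
  simp only [mul_zero, Real.exp_zero, one_mul, intervalIntegral.integral_same, add_zero,
    sub_zero, e0] at key
  have kp0 := mul_nonneg hK0 p0
  have kpT := mul_le_mul_of_nonneg_left pT' hK0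
  have hDR : σ ^ 2 / 4 * (∫ t in (0:ℝ)..T, D t) ≤ R := by
    rw [hR]
    linarith
  have hDR' : ∫ t in (0:ℝ)..T, D t ≤ 4 / σ ^ 2 * R := by
    calc ∫ t in (0:ℝ)..T, D t = 4 / σ ^ 2 * (σ ^ 2 / 4 * ∫ t in (0:ℝ)..T, D t) := by field_simp
      _ ≤ _ := by gcongr
  calc _ ≤ ∫ t in (0:ℝ)..T, D t := h.integral_mx_sq_le_integral_dissipation hdata
    _ ≤ 4 / σ ^ 2 * R := hDR'
    _ ≤ |4 / σ ^ 2 * R| + 1 := by linarith [le_abs_self (4 / σ ^ 2 * R)]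
end
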